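/- arXiv:1601.01067 — 5 statements merged into one kernel-verified Lean document; each statement's English description precedes it below -/
import Mathlib

section
/- Let f₁,…,f_m ∈ ℤ[x] be polynomials, not all zero, with d = max_i deg(f_i) ≥ 1 and h = max_i height(f_i), and let I be the ideal of ℤ[x] generated by f₁,…,f_m. If {g₁,…,g_s} is a reduced Gröbner basis of I, then for every i, deg(g_i) ≤ d and height(g_i) ≤ (2d+1)(h + d·log 2 + log(d+1)). -/
open Polynomial

/-- The height of an integer polynomial: the natural logarithm of the maximum of the
absolute values of its coefficients (the height of 0 is 0, since `Real.log 0 = 0`). -/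
noncomputable def polyHeight (f : Polynomial ℤ) : ℝ :=
  Real.log (((Finset.range (f.natDegree + 1)).sup fun k => (f.coeff k).natAbs : ℕ) : ℝ)

/-- A finite set `G` of nonzero polynomials in ℤ[x] with positive leading coefficients
is a Gröbner basis of an ideal `I ⊆ ℤ[x]` if `G ⊆ I`, `G` generates `I`, and for
every nonzero `f ∈ I` there is a `g ∈ G` with `deg g ≤ deg f` and `lc g ∣ lc f`. -/
def IsGroebnerBasis (G : Finset (Polynomial ℤ)) (I : Ideal (Polynomial ℤ)) : Prop :=
  (∀ g ∈ G, g ≠ 0 ∧ 0 < g.leadingCoeff) ∧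
  (↑G : Set (Polynomial ℤ)) ⊆ (I : Set (Polynomial ℤ)) ∧
  Ideal.span (↑G : Set (Polynomial ℤ)) = I ∧
  ∀ f ∈ I, f ≠ 0 → ∃ g ∈ G, g.natDegree ≤ Polynomial.natDegree f ∧
    g.leadingCoeff ∣ f.leadingCoeff

/-- A Gröbner basis `G` is reduced if moreover for all `g ≠ g'` in `G` and every
`k ≥ deg g'`, the coefficient of `x^k` in `g` lies in `[0, lc g')`. -/
def IsReducedGroebnerBasis (G : Finset (Polynomial ℤ)) (I : Ideal (Polynomial ℤ)) : Prop :=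
  IsGroebnerBasis G I ∧
  ∀ g ∈ G, ∀ g' ∈ G, g ≠ g' → ∀ k : ℕ, g'.natDegree ≤ k →
    0 ≤ g.coeff k ∧ g.coeff k < g'.leadingCoeff


/-- Induction principle for ideals of integer polynomials. -/
lemma span_poly_induction {m : ℕ} (f : Fin m → Polynomial ℤ) (P : Polynomial ℤ → Prop)
    (h0 : P 0) (hadd : ∀ p q, P p → P q → P (p + q)) (hC : ∀ (k : ℤ) p, P p → P (C k * p))
    (hX : ∀ p, P p → P (X * p)) (hf : ∀ i, P (f i)) :
    ∀ p ∈ Ideal.span (Set.range f), P p := by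
  intro p hp
  induction hp using Submodule.span_induction with
  | mem x hx => obtain ⟨i, rfl⟩ := hx; exact hf i
  | zero => exact h0
  | add x y _ _ hx hy => exact hadd x y hx hy
  | smul a x _ hx =>
    rw [smul_eq_mul]
    induction a using Polynomial.induction_on with
    | C k => exact hC k x hx
    | add p q hp hq => rw [add_mul]; exact hadd _ _ hp hq
    | monomial n k ih =>
      have : C k * X ^ (n + 1) * x = X * (C k * X ^ n * x) := by ring
      rw [this]; exact hX _ ih

/-- Elements of the ideal of degree at least `e` have leading coefficient divisible by that of
some element of degree `e`. -/
lemma top_struct {m : ℕ} (f : Fin m → Polynomial ℤ) (e : ℕ) (he : ∀ i, (f i).natDegree ≤ e)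
    (hne : ∃ i, (f i).coeff e ≠ 0) :
    ∃ p ∈ Ideal.span (Set.range f), p.natDegree = e ∧ p ≠ 0 ∧
      ∀ q ∈ Ideal.span (Set.range f), e ≤ q.natDegree → p.leadingCoeff ∣ q.leadingCoeff := by
  classical
  set I := Ideal.span (Set.range f) with hI
  let J : Submodule ℤ ℤ := Submodule.map (lcoeff ℤ e)
    (Submodule.restrictScalars ℤ I ⊓ Polynomial.degreeLE ℤ (e : WithBot ℕ))
  have memJ : ∀ q ∈ I, (∀ k, e < k → q.coeff k = 0) → q.coeff e ∈ J := by
    intro q hq hk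
    refine ⟨q, ⟨hq, mem_degreeLE.2 ((degree_le_iff_coeff_zero _ _).2 fun k hk' => hk k ?_)⟩, rfl⟩
    exact_mod_cast hk'
  have hfI : ∀ i, f i ∈ I := fun i => Ideal.subset_span ⟨i, rfl⟩
  obtain ⟨c, hc⟩ : ∃ c, J = Ideal.span {c} := (IsPrincipalIdealRing.principal (J : Ideal ℤ)).1
  have hcJ : c ∈ J := by rw [hc]; exact Ideal.mem_span_singleton_self c
  have hdvd : ∀ q ∈ I, (∀ k, e < k → q.coeff k = 0) → c ∣ q.coeff e := by
    intro q hq hk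
    have := memJ q hq hk
    rw [hc] at this
    exact Ideal.mem_span_singleton.1 this
  have hfc : ∀ i k, e < k → (f i).coeff k = 0 := fun i k hk =>
    coeff_eq_zero_of_natDegree_lt (lt_of_le_of_lt (he i) hk)
  have hc0 : c ≠ 0 := by
    rintro rfl
    obtain ⟨i, hi⟩ := hne
    exact hi (zero_dvd_iff.1 (hdvd _ (hfI i) (hfc i)))
  obtain ⟨p, ⟨hpI, hpd⟩, hpc⟩ := hcJ
  have hpc : p.coeff e = c := hpc
  have hpd' : p.natDegree ≤ e := natDegree_le_of_degree_le (mem_degreeLE.1 hpd)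
  have hpn : p.natDegree = e := le_antisymm hpd' (le_natDegree_of_ne_zero (by rw [hpc]; exact hc0))
  have hpk : ∀ k, e < k → p.coeff k = 0 := fun k hk =>
    coeff_eq_zero_of_natDegree_lt (by omega)
  have key : ∀ q ∈ I, (∀ k, e < k → q.coeff k = 0) →
      ∃ a : ℤ, ∃ s ∈ I, (∀ k, e ≤ k → s.coeff k = 0) ∧ q = C a * p + s := by
    intro q hq hk
    obtain ⟨a, ha⟩ := hdvd q hq hk
    refine ⟨a, q - C a * p, I.sub_mem hq (I.mul_mem_left _ hpI), ?_, by ring⟩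
    intro k hek
    rw [coeff_sub, coeff_C_mul]
    rcases hek.eq_or_lt with rfl | h
    · rw [ha, hpc]; ring
    · rw [hk k h, hpk k h]; ring
  have main : ∀ q ∈ I, ∃ a : Polynomial ℤ, ∃ s ∈ I,
      (∀ k, e ≤ k → s.coeff k = 0) ∧ q = a * p + s := by
    apply span_poly_induction
    · exact ⟨0, 0, I.zero_mem, by simp, by simp⟩
    · rintro _ _ ⟨a, s, hs, hs', rfl⟩ ⟨b, t, ht, ht', rfl⟩
      exact ⟨a + b, s + t, I.add_mem hs ht, fun k hk => by simp [hs' k hk, ht' k hk], by ring⟩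
    · rintro z _ ⟨a, s, hs, hs', rfl⟩
      exact ⟨C z * a, C z * s, I.mul_mem_left _ hs, fun k hk => by simp [hs' k hk], by ring⟩
    · rintro _ ⟨a, s, hs, hs', rfl⟩
      obtain ⟨b, t, ht, ht', h⟩ := key (X * s) (I.mul_mem_left _ hs) (by
        intro k hk
        obtain ⟨k, rfl⟩ : ∃ j, k = j + 1 := ⟨k - 1, by omega⟩
        rw [coeff_X_mul]; exact hs' k (by omega))
      exact ⟨X * a + C b, t, ht, ht', by rw [mul_add, h]; ring⟩
    · intro i
      obtain ⟨b, t, ht, ht', h⟩ := key (f i) (hfI i) (hfc i)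
      exact ⟨C b, t, ht, ht', h⟩
  have hp0 : p ≠ 0 := by rintro rfl; exact hc0 (by simpa using hpc.symm)
  refine ⟨p, hpI, hpn, hp0, ?_⟩
  intro q hq hqe
  obtain ⟨a, s, hs, hs', rfl⟩ := main q hq
  by_cases ha : a = 0
  · subst ha
    simp only [zero_mul, zero_add] at hqe ⊢
    rw [← coeff_natDegree (p := s), hs' _ hqe]
    exact dvd_zero _
  · have hlt : s.degree < (a * p).degree := by
      have h1 : s.degree < (e : WithBot ℕ) := (degree_lt_iff_coeff_zero _ _).2 hs'
      refine lt_of_lt_of_le h1 ?_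
      rw [degree_eq_natDegree (mul_ne_zero ha hp0), natDegree_mul ha hp0, hpn]
      exact_mod_cast Nat.le_add_left _ _
    rw [leadingCoeff_add_of_degree_lt' hlt, leadingCoeff_mul]
    exact dvd_mul_left _ _

/-- Integer multiples of low-degree ideal elements are integer combinations of few shifts. -/
lemma low_span {m : ℕ} (f : Fin m → Polynomial ℤ) (d e : ℕ) (hd : 1 ≤ d) (hed : e ≤ d)
    (he : ∀ i, (f i).natDegree ≤ e) (i0 : Fin m) (hi0 : (f i0).natDegree = e) (hf0 : f i0 ≠ 0) :
    ∀ p ∈ Ideal.span (Set.range f), (∀ k, e + d ≤ k → p.coeff k = 0) → ∃ c : ℤ, c ≠ 0 ∧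
      C c * p ∈ Submodule.span ℤ (Set.range fun x : Fin m × Fin d => X ^ (x.2 : ℕ) * f x.1) := by
  set S := Submodule.span ℤ (Set.range fun x : Fin m × Fin d => X ^ (x.2 : ℕ) * f x.1) with hS
  have hC : ∀ (k : ℤ) s, s ∈ S → C k * s ∈ S := by
    intro k s hs
    rw [← smul_eq_C_mul]; exact S.smul_mem k hs
  have hgen : ∀ i j, j < d → X ^ j * f i ∈ S := fun i j hj =>
    Submodule.subset_span ⟨(i, ⟨j, hj⟩), rfl⟩
  have hmul : ∀ i (r : Polynomial ℤ), (∀ k, d ≤ k → r.coeff k = 0) → r * f i ∈ S := by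
    intro i r hr
    have hr' : r.natDegree < d := by
      by_contra h
      push Not at h
      have := hr _ h
      rw [coeff_natDegree, leadingCoeff_eq_zero] at this
      subst this
      simp at h; omega
    rw [r.as_sum_range' d hr', Finset.sum_mul]
    refine S.sum_mem fun j hj => ?_
    rw [← C_mul_X_pow_eq_monomial, mul_assoc]
    exact hC _ _ (hgen i j (Finset.mem_range.1 hj))
  have hSdeg : ∀ s ∈ S, ∀ k, e + d ≤ k → s.coeff k = 0 := by
    intro s hs
    induction hs using Submodule.span_induction with
    | mem x hx =>
      obtain ⟨⟨i, j⟩, rfl⟩ := hx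
      intro k hk
      have hj := j.2
      simp only
      rw [coeff_X_pow_mul', if_pos (by omega)]
      exact coeff_eq_zero_of_natDegree_lt (by have := he i; omega)
    | zero => simp
    | add x y _ _ hx hy => intro k hk; simp [hx k hk, hy k hk]
    | smul a x _ hx => intro k hk; simp [hx k hk]
  set l := (f i0).leadingCoeff with hl
  have hl0 : l ≠ 0 := leadingCoeff_ne_zero.2 hf0
  have hXS : ∀ s ∈ S, ∃ c : ℤ, c ≠ 0 ∧ ∃ q, ∃ t ∈ S, C c * (X * s) = q * f i0 + t := by
    intro s hs
    refine ⟨l, hl0, ?_⟩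
    induction hs using Submodule.span_induction with
    | mem x hx =>
      obtain ⟨⟨i, j⟩, rfl⟩ := hx
      simp only
      by_cases hj : (j : ℕ) + 1 < d
      · refine ⟨0, C l * (X ^ ((j : ℕ) + 1) * f i), hC _ _ (hgen i _ hj), by ring⟩
      · have hj' : (j : ℕ) + 1 = d := by have := j.2; omega
        refine ⟨X ^ (d - e) * f i, -(X ^ (d - e) * (f i0).eraseLead) * f i, hmul _ _ ?_, ?_⟩
        · intro k hk
          rw [coeff_neg, coeff_X_pow_mul', if_pos (by omega), eraseLead_coeff]
          split_ifs with h
          · simp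
          · rw [coeff_eq_zero_of_natDegree_lt (by omega)]; simp
        · have h1 := eraseLead_add_C_mul_X_pow (f i0)
          rw [hi0, ← hl] at h1
          have h2 : (X : Polynomial ℤ) ^ ((j : ℕ) + 1) = X ^ (d - e) * X ^ e := by
            rw [hj', ← pow_add]; congr 1; omega
          calc C l * (X * (X ^ (j : ℕ) * f i)) = C l * X ^ ((j : ℕ) + 1) * f i := by ring
            _ = X ^ (d - e) * f i * ((f i0).eraseLead + C l * X ^ e)
              + -(X ^ (d - e) * (f i0).eraseLead) * f i := by rw [h2]; ring
            _ = _ := by rw [h1]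
    | zero => exact ⟨0, 0, S.zero_mem, by simp⟩
    | add x y _ _ hx hy =>
      obtain ⟨q, t, ht, h⟩ := hx
      obtain ⟨q', t', ht', h'⟩ := hy
      exact ⟨q + q', t + t', S.add_mem ht ht', by rw [mul_add, mul_add, h, h']; ring⟩
    | smul a x _ hx =>
      obtain ⟨q, t, ht, h⟩ := hx
      refine ⟨C a * q, C a * t, hC _ _ ht, ?_⟩
      rw [smul_eq_C_mul]
      calc C l * (X * (C a * x)) = C a * (C l * (X * x)) := by ring
        _ = _ := by rw [h]; ring
  have main : ∀ p ∈ Ideal.span (Set.range f),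
      ∃ c : ℤ, c ≠ 0 ∧ ∃ q, ∃ t ∈ S, C c * p = q * f i0 + t := by
    apply span_poly_induction
    · exact ⟨1, one_ne_zero, 0, 0, S.zero_mem, by simp⟩
    · rintro p p' ⟨c, hc, q, t, ht, h⟩ ⟨c', hc', q', t', ht', h'⟩
      refine ⟨c * c', mul_ne_zero hc hc', C c' * q + C c * q', C c' * t + C c * t',
        S.add_mem (hC _ _ ht) (hC _ _ ht'), ?_⟩
      calc C (c * c') * (p + p') = C c' * (C c * p) + C c * (C c' * p') := by
            rw [C_mul]; ring
        _ = _ := by rw [h, h']; ring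
    · rintro k p ⟨c, hc, q, t, ht, h⟩
      refine ⟨c, hc, C k * q, C k * t, hC _ _ ht, ?_⟩
      calc C c * (C k * p) = C k * (C c * p) := by ring
        _ = _ := by rw [h]; ring
    · rintro p ⟨c, hc, q, t, ht, h⟩
      obtain ⟨c', hc', q', t', ht', h'⟩ := hXS t ht
      refine ⟨c * c', mul_ne_zero hc hc', C c' * X * q + q', t', ht', ?_⟩
      calc C (c * c') * (X * p) = C c' * X * (C c * p) := by rw [C_mul]; ring
        _ = C c' * X * q * f i0 + C c' * (X * t) := by rw [h]; ring
        _ = _ := by rw [h']; ring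
    · intro i
      refine ⟨1, one_ne_zero, 0, f i, ?_, by simp⟩
      simpa using hgen i 0 (by omega)
  intro p hp hpd
  obtain ⟨c, hc, q, t, ht, h⟩ := main p hp
  refine ⟨c, hc, ?_⟩
  rw [h]
  refine S.add_mem (hmul _ _ ?_) ht
  have hq : ∀ k, e + d ≤ k → (q * f i0).coeff k = 0 := by
    intro k hk
    have : q * f i0 = C c * p - t := by rw [h]; ring
    rw [this, coeff_sub, coeff_C_mul, hpd k hk, hSdeg t ht k hk]; simp
  intro k hk
  by_cases hq0 : q = 0
  · simp [hq0]
  · apply coeff_eq_zero_of_natDegree_lt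
    by_contra hlt
    have h1 := hq (q * f i0).natDegree (by rw [natDegree_mul hq0 hf0, hi0]; omega)
    rw [coeff_natDegree, leadingCoeff_eq_zero] at h1
    exact mul_ne_zero hq0 hf0 h1

/-- An integer matrix with trivial kernel has a nonzero maximal minor. -/
lemma exists_minor {ι : Type*} [Fintype ι] {n : ℕ} (A : Matrix ι (Fin n) ℤ)
    (hA : ∀ φ : Fin n → ℤ, (∀ x, ∑ t, A x t * φ t = 0) → φ = 0) :
    ∃ r : Fin n → ι, (A.submatrix r id).det ≠ 0 := by
  classical
  let B : Matrix ι (Fin n) ℚ := A.map (Int.castRingHom ℚ)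
  have hinj : ∀ ψ : Fin n → ℚ, B.mulVec ψ = 0 → ψ = 0 := by
    intro ψ hψ
    obtain ⟨b, hb⟩ := IsLocalization.exist_integer_multiples_of_finite (nonZeroDivisors ℤ) ψ
    choose φ hφ using hb
    have hb0 : ((b : ℤ) : ℚ) ≠ 0 := by
      exact_mod_cast nonZeroDivisors.ne_zero b.2
    have hφ' : ∀ t, ((φ t : ℤ) : ℚ) = (b : ℤ) * ψ t := by
      intro t
      have := hφ t
      simpa using this
    have h0 := hA φ (fun x => by
      have h1 := congrFun hψ x
      simp only [Matrix.mulVec, dotProduct, Pi.zero_apply] at h1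
      have : ((∑ t, A x t * φ t : ℤ) : ℚ) = (b : ℤ) * ∑ t, B x t * ψ t := by
        push_cast
        rw [Finset.mul_sum]
        refine Finset.sum_congr rfl fun t _ => ?_
        rw [hφ']; simp [B]; ring
      rw [h1, mul_zero] at this
      exact_mod_cast this)
    funext t
    have := hφ' t
    rw [h0] at this
    rw [Pi.zero_apply, Int.cast_zero] at this
    exact (mul_eq_zero.1 this.symm).resolve_left hb0
  have hrank : B.rank = n := by
    rw [Matrix.rank, LinearMap.finrank_range_of_inj]
    · simp
    · rw [← LinearMap.ker_eq_bot, LinearMap.ker_eq_bot']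
      intro ψ h
      exact hinj ψ h
  rw [Matrix.rank_eq_finrank_span_row] at hrank
  obtain ⟨v, hv, -, hli⟩ := Submodule.exists_fun_fin_finrank_span_eq ℚ (Set.range B.row)
  choose r hr using hv
  refine ⟨fun i => r (Fin.cast hrank.symm i), ?_⟩
  have hli' : LinearIndependent ℚ (B.submatrix (fun i => r (Fin.cast hrank.symm i)) id).row := by
    have hfun : (B.submatrix (fun i => r (Fin.cast hrank.symm i)) id).row
        = v ∘ Fin.cast hrank.symm := by
      funext i
      rw [Function.comp, ← hr]; rfl
    rw [hfun]
    exact hli.comp (Fin.cast hrank.symm) (Fin.cast_injective _)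
  rw [Matrix.linearIndependent_rows_iff_isUnit, Matrix.isUnit_iff_isUnit_det] at hli'
  intro h
  apply hli'.ne_zero
  have : B.submatrix (fun i => r (Fin.cast hrank.symm i)) id
      = (A.submatrix (fun i => r (Fin.cast hrank.symm i)) id).map (Int.castRingHom ℚ) := rfl
  rw [this, ← RingHom.mapMatrix_apply, ← RingHom.map_det, h]; simp

/-- Cramer's rule: bounded ideal elements in echelon form. -/
lemma cramer_elems {m : ℕ} (f : Fin m → Polynomial ℤ) (d e : ℕ) (hd : 1 ≤ d) (hed : e ≤ d)
    (he : ∀ i, (f i).natDegree ≤ e) (i0 : Fin m) (hi0 : (f i0).natDegree = e) (hf0 : f i0 ≠ 0)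
    (H : ℕ) (hH : ∀ i k, |(f i).coeff k| ≤ (H : ℤ)) (p0 : Polynomial ℤ)
    (hp0 : p0 ∈ Ideal.span (Set.range f)) (hp0n : p0 ≠ 0) (n : ℕ) (hn : p0.natDegree + n = e + d) :
    ∃ Δ : ℤ, Δ ≠ 0 ∧ ∃ w : Fin n → Polynomial ℤ, ∀ t, w t ∈ Ideal.span (Set.range f) ∧
      (∀ k, p0.natDegree ≤ k → (w t).coeff k = if k = p0.natDegree + t then Δ else 0) ∧
      ∀ k, |(w t).coeff k| ≤ ((n.factorial * H ^ n : ℕ) : ℤ) := by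
  classical
  set k0 := p0.natDegree with hk0
  set row : Fin m × Fin d → Polynomial ℤ := fun x => X ^ (x.2 : ℕ) * f x.1 with hrow
  have hrowI : ∀ x, row x ∈ Ideal.span (Set.range f) := fun x =>
    Ideal.mul_mem_left _ _ (Ideal.subset_span ⟨x.1, rfl⟩)
  have hrowH : ∀ x k, |(row x).coeff k| ≤ (H : ℤ) := by
    intro x k
    simp only [hrow]
    rw [coeff_X_pow_mul']
    split_ifs
    · exact hH _ _
    · simp
  have hrow0 : ∀ x k, e + d ≤ k → (row x).coeff k = 0 := by
    rintro ⟨i, j⟩ k hk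
    have hj := j.2
    simp only [hrow]
    rw [coeff_X_pow_mul', if_pos (by omega)]
    exact coeff_eq_zero_of_natDegree_lt (by have := he i; omega)
  let A : Matrix (Fin m × Fin d) (Fin n) ℤ := fun x t => (row x).coeff (k0 + t)
  obtain ⟨r, hr⟩ := exists_minor A (by
    intro φ hφ
    by_contra hne
    have hex : ∃ t : ℕ, ∃ h : t < n, φ ⟨t, h⟩ ≠ 0 := by
      obtain ⟨t, ht⟩ := Function.ne_iff.1 hne
      exact ⟨t, t.2, ht⟩
    obtain ⟨htn, htφ⟩ := Nat.find_spec hex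
    set t := Nat.find hex with ht
    have hmin : ∀ s : Fin n, (s : ℕ) < t → φ s = 0 := by
      intro s hs
      by_contra h
      exact Nat.find_min hex hs ⟨s.2, h⟩
    obtain ⟨c, hc, hcS⟩ := low_span f d e hd hed he i0 hi0 hf0 (X ^ t * p0)
      (Ideal.mul_mem_left _ _ hp0) (by
        intro k hk
        rw [coeff_X_pow_mul', if_pos (by omega)]
        exact coeff_eq_zero_of_natDegree_lt (by omega))
    have hvan : ∀ s ∈ Submodule.span ℤ (Set.range row), ∑ u : Fin n, s.coeff (k0 + u) * φ u = 0 := by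
      intro s hs
      induction hs using Submodule.span_induction with
      | mem x hx => obtain ⟨y, rfl⟩ := hx; exact hφ y
      | zero => simp
      | add x y _ _ hx hy => simp [add_mul, Finset.sum_add_distrib, hx, hy]
      | smul a x _ hx =>
        simp only [coeff_smul, smul_eq_mul, mul_assoc]
        rw [← Finset.mul_sum, hx, mul_zero]
    have h1 := hvan _ hcS
    rw [Finset.sum_eq_single (⟨t, htn⟩ : Fin n)] at h1
    · simp only [coeff_C_mul] at h1
      rw [coeff_X_pow_mul, hk0, coeff_natDegree] at h1
      exact mul_ne_zero (mul_ne_zero hc (leadingCoeff_ne_zero.2 hp0n)) htφ h1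
    · intro u _ hu
      rcases lt_trichotomy (u : ℕ) t with h | h | h
      · rw [hmin u h, mul_zero]
      · exact absurd (Fin.ext h) hu
      · rw [coeff_C_mul, coeff_X_pow_mul', if_pos (by omega),
          coeff_eq_zero_of_natDegree_lt (by omega)]; simp
    · simp)
  set A' := A.submatrix r id with hA'
  have hco : ∀ t k, (∑ s, C (A'.adjugate t s) * row (r s)).coeff k
      = (A'.updateCol t (fun s => (row (r s)).coeff k)).det := by
    intro t k
    rw [← Matrix.cramer_apply, Matrix.cramer_eq_adjugate_mulVec, finsetSum_coeff]
    simp only [coeff_C_mul]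
    rfl
  refine ⟨A'.det, hr, fun t => ∑ s, C (A'.adjugate t s) * row (r s), fun t => ⟨?_, ?_, ?_⟩⟩
  · exact Ideal.sum_mem _ fun s _ => Ideal.mul_mem_left _ _ (hrowI _)
  · intro k hk
    by_cases hkn : k < k0 + n
    · obtain ⟨u, rfl⟩ : ∃ u, k = k0 + u := ⟨k - k0, by omega⟩
      have hun : u < n := by omega
      have h1 := congrFun (congrFun A'.adjugate_mul t) ⟨u, hun⟩
      rw [Matrix.mul_apply] at h1
      rw [finsetSum_coeff]
      simp only [coeff_C_mul]
      refine Eq.trans h1 ?_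
      rw [Matrix.smul_apply, Matrix.one_apply]
      by_cases htu : (u : ℕ) = t
      · rw [if_pos (Fin.ext htu.symm), if_pos (by omega)]; simp
      · rw [if_neg (fun h => htu (by rw [h])), if_neg (by omega)]; simp
    · rw [if_neg (by have := t.2; omega), finsetSum_coeff]
      refine Finset.sum_eq_zero fun s _ => ?_
      rw [coeff_C_mul, hrow0 _ _ (by omega), mul_zero]
  · intro k
    rw [hco]
    have := Matrix.det_le (abv := AbsoluteValue.abs) (x := (H : ℤ))
      (A := A'.updateCol t (fun s => (row (r s)).coeff k)) (by
        intro i j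
        rw [AbsoluteValue.abs_apply, Matrix.updateCol_apply]
        split_ifs
        · exact hrowH _ _
        · exact hrowH _ _)
    rw [AbsoluteValue.abs_apply, Fintype.card_fin] at this
    simpa using this

/-- Coefficient bound for the height. -/
lemma abs_coeff_le_of_polyHeight (f : Polynomial ℤ) (h : ℝ) (hf : polyHeight f ≤ h) (k : ℕ) :
    |f.coeff k| ≤ ((⌊Real.exp h⌋₊ : ℕ) : ℤ) := by
  by_cases hk : f.coeff k = 0
  · rw [hk, abs_zero]; positivity
  have hle : (f.coeff k).natAbs ≤
      (Finset.range (f.natDegree + 1)).sup fun k => (f.coeff k).natAbs :=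
    Finset.le_sup (f := fun k => (f.coeff k).natAbs)
      (Finset.mem_range.2 (Nat.lt_succ_of_le (le_natDegree_of_ne_zero hk)))
  rw [polyHeight] at hf
  set s := (Finset.range (f.natDegree + 1)).sup fun k => (f.coeff k).natAbs
  have hpos : 0 < (f.coeff k).natAbs := Int.natAbs_pos.2 hk
  have hs : (s : ℝ) ≤ Real.exp h :=
    (Real.log_le_iff_le_exp (by exact_mod_cast lt_of_lt_of_le hpos hle)).1 hf
  have h2 : s ≤ ⌊Real.exp h⌋₊ := Nat.le_floor hs
  rw [Int.abs_eq_natAbs]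
  exact_mod_cast hle.trans h2

lemma polyHeight_nonneg (f : Polynomial ℤ) : 0 ≤ polyHeight f := Real.log_natCast_nonneg _

/-- Let f₁,…,f_m ∈ ℤ[x], not all zero, with d = max deg(f_i) ≥ 1 and
h = max height(f_i), and let I = (f₁,…,f_m) ⊆ ℤ[x]. If {g₁,…,g_s} is a reduced
Gröbner basis of I, then every g_i satisfies deg(g_i) ≤ d and
height(g_i) ≤ (2d+1)(h + d·log 2 + log(d+1)). -/
theorem stmt5 {m : ℕ} (f : Fin m → Polynomial ℤ) (hne : ∃ i, f i ≠ 0)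
    (d : ℕ) (hd1 : 1 ≤ d) (hd : ∀ i, (f i).natDegree ≤ d)
    (h : ℝ) (hh : ∀ i, polyHeight (f i) ≤ h)
    (G : Finset (Polynomial ℤ))
    (hG : IsReducedGroebnerBasis G (Ideal.span (Set.range f))) :
    ∀ g ∈ G, g.natDegree ≤ d ∧
      polyHeight g ≤ (2 * (d : ℝ) + 1) * (h + (d : ℝ) * Real.log 2 + Real.log ((d : ℝ) + 1)) := by
  classical
  set I := Ideal.span (Set.range f) with hI
  obtain ⟨⟨hpos, hGI, -, hgb⟩, hred⟩ := hG
  obtain ⟨j0, hj0⟩ := hne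
  -- an element of maximal degree among the nonzero generators
  obtain ⟨i0, hi0mem, hi0max⟩ := Finset.exists_max_image
    (Finset.univ.filter fun i => f i ≠ 0) (fun i => (f i).natDegree) ⟨j0, by simpa using hj0⟩
  have hf0 : f i0 ≠ 0 := by simpa using hi0mem
  set e := (f i0).natDegree with he0
  have he : ∀ i, (f i).natDegree ≤ e := by
    intro i
    by_cases h0 : f i = 0
    · simp [h0]
    · exact hi0max i (by simpa using h0)
  have hed : e ≤ d := hd i0
  -- the degree bound
  have hdeg : ∀ g ∈ G, g.natDegree ≤ e := by
    intro g hg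
    obtain ⟨p, hpI, hpn, hp0, hpd⟩ := top_struct f e he
      ⟨i0, by rw [he0, coeff_natDegree]; exact leadingCoeff_ne_zero.2 hf0⟩
    obtain ⟨g', hg', hdeg', hlc'⟩ := hgb p hpI hp0
    by_contra hlt
    push Not at hlt
    have hne : g ≠ g' := by rintro rfl; omega
    have h1 := (hred g hg g' hg' hne g.natDegree (by omega)).2
    rw [coeff_natDegree] at h1
    have h2 := Int.le_of_dvd (hpos g hg).2 (hlc'.trans (hpd g (hGI hg) (by omega)))
    omega
  intro g hg
  refine ⟨(hdeg g hg).trans hed, ?_⟩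
  have hh0 : 0 ≤ h := (polyHeight_nonneg _).trans (hh i0)
  set H := ⌊Real.exp h⌋₊ with hHdef
  have hH1 : 1 ≤ H := Nat.le_floor (by simpa using hh0)
  have hHe : (H : ℝ) ≤ Real.exp h := Nat.floor_le (Real.exp_pos h).le
  -- an element of minimal degree
  have hex : ∃ k : ℕ, ∃ p ∈ I, p ≠ 0 ∧ p.natDegree = k :=
    ⟨e, f i0, Ideal.subset_span ⟨i0, rfl⟩, hf0, rfl⟩
  obtain ⟨p0, hp0I, hp0, hp0k⟩ := Nat.find_spec hex
  have hk0e : p0.natDegree ≤ e := by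
    rw [hp0k]; exact Nat.find_min' hex ⟨f i0, Ideal.subset_span ⟨i0, rfl⟩, hf0, rfl⟩
  have hmin : ∀ q ∈ I, (∀ k, p0.natDegree ≤ k → q.coeff k = 0) → q = 0 := by
    intro q hq hk
    by_contra hq0
    have h1 : p0.natDegree ≤ q.natDegree := by
      rw [hp0k]; exact Nat.find_min' hex ⟨q, hq, hq0, rfl⟩
    have := hk _ h1
    rw [coeff_natDegree, leadingCoeff_eq_zero] at this
    exact hq0 this
  obtain ⟨n, hn⟩ : ∃ n, p0.natDegree + n = e + d := ⟨e + d - p0.natDegree, by omega⟩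
  have hn0 : 0 < n := by omega
  obtain ⟨Δ, hΔ, w, hw⟩ := cramer_elems f d e hd1 hed he i0 rfl hf0 H
    (fun i k => abs_coeff_le_of_polyHeight (f i) h (hh i) k) p0 hp0I hp0 n hn
  set k0 := p0.natDegree with hk0
  set B : ℕ := n.factorial * H ^ n with hB
  -- coefficients in degree at least `k0` are bounded by `|Δ|`
  have hlow : ∀ k, k0 ≤ k → |g.coeff k| ≤ |Δ| := by
    obtain ⟨hwI, hwc, -⟩ := hw ⟨0, hn0⟩
    have hwk : (w ⟨0, hn0⟩).coeff k0 = Δ := by rw [hwc k0 le_rfl]; simp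
    have hwdeg : (w ⟨0, hn0⟩).natDegree = k0 := by
      apply le_antisymm
      · rw [natDegree_le_iff_coeff_eq_zero]
        intro k hk
        rw [hwc k hk.le, if_neg (by simp; omega)]
      · exact le_natDegree_of_ne_zero (by rw [hwk]; exact hΔ)
    have hw0 : w ⟨0, hn0⟩ ≠ 0 := by
      intro h0; rw [h0] at hwk; exact hΔ (by simpa using hwk.symm)
    obtain ⟨g', hg', hdeg', hlc'⟩ := hgb _ hwI hw0
    rw [← coeff_natDegree (p := w ⟨0, hn0⟩), hwdeg, hwk] at hlc'
    rw [hwdeg] at hdeg'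
    have hle : g'.leadingCoeff ≤ |Δ| :=
      Int.le_of_dvd (abs_pos.2 hΔ) ((dvd_abs _ _).2 hlc')
    have hgpos := (hpos g' hg').2
    intro k hk
    by_cases hgg : g = g'
    · rcases (hdeg'.trans hk).eq_or_lt with h1 | h1
      · rw [hgg, ← h1, coeff_natDegree, abs_of_pos hgpos]; exact hle
      · rw [hgg, coeff_eq_zero_of_natDegree_lt h1]; simp
    · obtain ⟨h1, h2⟩ := hred g hg g' hg' hgg k (by omega)
      rw [abs_of_nonneg h1]; omega
  have hrep : C Δ * g = ∑ t : Fin n, C (g.coeff (k0 + t)) * w t := by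
    rw [← sub_eq_zero]
    apply hmin
    · exact I.sub_mem (I.mul_mem_left _ (hGI hg))
        (I.sum_mem fun t _ => I.mul_mem_left _ (hw t).1)
    · intro k hk
      rw [coeff_sub, coeff_C_mul, finsetSum_coeff]
      simp only [coeff_C_mul]
      by_cases hkn : k < k0 + n
      · rw [Finset.sum_eq_single (⟨k - k0, by omega⟩ : Fin n)]
        · rw [(hw _).2.1 k hk, if_pos (by simp; omega)]
          have : k0 + (k - k0) = k := by omega
          simp only [this]
          ring
        · intro u _ hu
          rw [(hw _).2.1 k hk, if_neg, mul_zero]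
          intro h1
          apply hu
          apply Fin.ext
          simp only
          omega
        · simp
      · rw [coeff_eq_zero_of_natDegree_lt (by have := hdeg g hg; omega), Finset.sum_eq_zero]
        · simp
        · intro u _
          rw [(hw _).2.1 k hk, if_neg (by have := u.2; omega), mul_zero]
  have hcoef : ∀ k, |g.coeff k| ≤ ((n * B : ℕ) : ℤ) := by
    intro k
    have h1 : Δ * g.coeff k = ∑ t : Fin n, g.coeff (k0 + t) * (w t).coeff k := by
      have := congrArg (fun p => p.coeff k) hrep
      simpa only [coeff_C_mul, finsetSum_coeff] using this
    have h2 : |Δ| * |g.coeff k| ≤ |Δ| * ((n * B : ℕ) : ℤ) := by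
      rw [← abs_mul, h1]
      calc |∑ t : Fin n, g.coeff (k0 + t) * (w t).coeff k|
          ≤ ∑ t : Fin n, |g.coeff (k0 + t) * (w t).coeff k| := Finset.abs_sum_le_sum_abs _ _
        _ ≤ ∑ t : Fin n, |Δ| * (B : ℤ) := by
            refine Finset.sum_le_sum fun t _ => ?_
            rw [abs_mul]
            exact mul_le_mul (hlow _ (by omega)) ((hw t).2.2 k) (abs_nonneg _) (abs_nonneg _)
        _ = |Δ| * ((n * B : ℕ) : ℤ) := by
            rw [Finset.sum_const, Finset.card_univ, Fintype.card_fin]; push_cast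
            rw [nsmul_eq_mul]; ring
    exact le_of_mul_le_mul_left h2 (abs_pos.2 hΔ)
  have hn2 : n ≤ 2 * d := by omega
  have hnB : n * B ≤ (2 * d * H) ^ (2 * d + 1) := by
    calc n * B = n * n.factorial * H ^ n := by rw [hB]; ring
      _ ≤ n * n ^ n * H ^ n := by gcongr; exact Nat.factorial_le_pow n
      _ ≤ (2 * d) * (2 * d) ^ (2 * d) * H ^ (2 * d + 1) := by
          gcongr <;> omega
      _ = _ := by ring
  have hsup : ((Finset.range (g.natDegree + 1)).sup fun k => (g.coeff k).natAbs)
      ≤ (2 * d * H) ^ (2 * d + 1) := by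
    refine Finset.sup_le fun k _ => ?_
    have h1 := hcoef k
    rw [Int.abs_eq_natAbs] at h1
    have h2 : (g.coeff k).natAbs ≤ n * B := by exact_mod_cast h1
    exact h2.trans hnB
  have hdR : (1 : ℝ) ≤ d := by exact_mod_cast hd1
  have hHR : (1 : ℝ) ≤ H := by exact_mod_cast hH1
  have hlog2 : Real.log (2 * d * H : ℝ) ≤ h + d * Real.log 2 + Real.log ((d : ℝ) + 1) := by
    have h1 : (2 * d * H : ℝ) ≤ 2 ^ d * (d + 1) * Real.exp h := by
      have : (2 : ℝ) ≤ 2 ^ d := by simpa using pow_le_pow_right₀ (one_le_two (α := ℝ)) hd1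
      gcongr
      linarith
    calc Real.log (2 * d * H : ℝ) ≤ Real.log (2 ^ d * (d + 1) * Real.exp h) :=
          Real.log_le_log (by positivity) h1
      _ = _ := by
          rw [Real.log_mul (by positivity) (by positivity),
            Real.log_mul (by positivity) (by positivity), Real.log_pow, Real.log_exp]; ring
  have hlog3 : Real.log (((2 * d * H) ^ (2 * d + 1) : ℕ) : ℝ)
      ≤ (2 * (d : ℝ) + 1) * (h + (d : ℝ) * Real.log 2 + Real.log ((d : ℝ) + 1)) := by
    push_cast
    rw [Real.log_pow]
    push_cast
    exact mul_le_mul_of_nonneg_left hlog2 (by positivity)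
  refine le_trans ?_ hlog3
  rw [polyHeight]
  rcases Nat.eq_zero_or_pos
    ((Finset.range (g.natDegree + 1)).sup fun k => (g.coeff k).natAbs) with h0 | h0
  · rw [h0, Nat.cast_zero, Real.log_zero]; exact Real.log_natCast_nonneg _
  · exact Real.log_le_log (by exact_mod_cast h0) (by exact_mod_cast hsup)
end

section
/- Let p be a prime, let F ∈ ℤ[x]^{n×m} with d = deg(F) the maximum degree of its entries. Then the ℤ_(p)[x]-module Sol_{ℤ_(p)[x]}(F) = {Y ∈ ℤ_(p)[x]^m : FY = 0} is generated by finitely many vectors lying in ℤ[x]^m, each of whose entries has degree at most n·d. -/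
open Polynomial

instance span_int_prime_isPrime (p : ℕ) [hp : Fact p.Prime] :
    (Ideal.span {(p : ℤ)}).IsPrime :=
  (Ideal.span_singleton_prime (by exact_mod_cast hp.out.ne_zero)).mpr
    (Nat.prime_iff_prime_int.mp hp.out)

/-- ℤ_(p): the localization of ℤ at the prime ideal (p). -/
abbrev ZLoc (p : ℕ) [Fact p.Prime] : Type :=
  Localization.AtPrime (Ideal.span {(p : ℤ)})

/-- bordered determinant identity -/
lemma bordered_zero {A : Type*} [CommRing A] [IsDomain A] {r : ℕ}
    (P : Matrix (Fin r) (Fin r) A) (u w : Fin r → A) (c : A) (hP : P.det ≠ 0)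
    (h : (Matrix.fromBlocks P (Matrix.replicateCol Unit u) (Matrix.replicateRow Unit w)
      (Matrix.of fun _ _ => c)).det = 0) :
    P.det * c - ∑ b, w b * P.cramer u b = 0 := by
  have key : Matrix.fromBlocks P (Matrix.replicateCol Unit u) (Matrix.replicateRow Unit w)
      (Matrix.of fun _ _ => c) *
      Matrix.fromBlocks 1 (Matrix.replicateCol Unit (-(P.cramer u))) 0
        (Matrix.of fun _ _ : Unit => P.det)
      = Matrix.fromBlocks P 0 (Matrix.replicateRow Unit w)
        (Matrix.of fun _ _ : Unit => P.det * c - ∑ b, w b * P.cramer u b) := by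
    rw [Matrix.fromBlocks_multiply]
    congr 1
    · simp
    · ext i j
      have := congrFun (Matrix.mulVec_cramer P u) i
      simp only [Matrix.mulVec, dotProduct, Pi.smul_apply, smul_eq_mul] at this
      simp [Matrix.mul_apply, this]
      ring
    · simp
    · ext i j
      simp [Matrix.mul_apply]
      ring
  have h2 := congrArg Matrix.det key
  rw [Matrix.det_mul, h, zero_mul, Matrix.det_fromBlocks_zero₁₂] at h2
  simpa [hP] using h2.symm

lemma cramer_sol {A : Type*} [CommRing A] [IsDomain A] {n m r : ℕ}
    (F : Matrix (Fin n) (Fin m) A) (a : Fin r → Fin n) (b : Fin r → Fin m)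
    (h0 : (F.submatrix a b).det ≠ 0)
    (hmax : ∀ (a' : Fin (r+1) → Fin n) (b' : Fin (r+1) → Fin m), (F.submatrix a' b').det = 0)
    (i : Fin n) (f : Fin m) :
    (F.submatrix a b).det * F i f
      - ∑ k, F i (b k) * (F.submatrix a b).cramer (fun s => F (a s) f) k = 0 := by
  apply bordered_zero _ _ _ _ h0
  let e : Fin r ⊕ Unit ≃ Fin (r+1) := Fintype.equivFinOfCardEq (by simp)
  have := hmax (Sum.elim a (fun _ => i) ∘ e.symm) (Sum.elim b (fun _ => f) ∘ e.symm)
  rw [← Matrix.det_submatrix_equiv_self e] at this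
  rw [← this]
  congr 1
  ext x y
  rcases x with x | x <;> rcases y with y | y <;> simp

lemma det_deg {r n d : ℕ} (P : Matrix (Fin r) (Fin r) ℤ[X]) (hr : r ≤ n)
    (hd : ∀ i j, (P i j).natDegree ≤ d) : P.det.natDegree ≤ n * d := by
  rw [Matrix.det_apply]
  refine natDegree_sum_le_of_forall_le _ _ fun σ _ => ?_
  refine (natDegree_smul_le _ _).trans ?_
  refine (natDegree_prod_le _ _).trans ?_
  refine (Finset.sum_le_sum fun i _ => hd _ i).trans ?_
  simp only [Finset.sum_const, Finset.card_univ, Fintype.card_fin, smul_eq_mul]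
  exact Nat.mul_le_mul_right _ hr

/-- maximal size of a nonvanishing minor -/
lemma exists_max {A : Type*} [CommRing A] [IsDomain A] {n m : ℕ} (F : Matrix (Fin n) (Fin m) A) :
    ∃ r ≤ n, (∃ (a : Fin r → Fin n) (b : Fin r → Fin m), (F.submatrix a b).det ≠ 0) ∧
      ∀ (a' : Fin (r+1) → Fin n) (b' : Fin (r+1) → Fin m), (F.submatrix a' b').det = 0 := by
  classical
  let Q : ℕ → Prop := fun r => ∃ (a : Fin r → Fin n) (b : Fin r → Fin m), (F.submatrix a b).det ≠ 0
  have hle : ∀ r, Q r → r ≤ n := by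
    rintro r ⟨a, b, h⟩
    have : Function.Injective a := by
      intro x y hxy
      by_contra hne
      exact h (Matrix.det_zero_of_row_eq hne (by ext; simp [hxy]))
    simpa using Fintype.card_le_of_injective a this
  have h0 : Q 0 := ⟨Fin.elim0, Fin.elim0, by simp⟩
  refine ⟨Nat.findGreatest Q n, Nat.findGreatest_le n, Nat.findGreatest_spec (Nat.zero_le n) h0, ?_⟩
  intro a' b'
  by_contra h
  have hQ : Q (Nat.findGreatest Q n + 1) := ⟨a', b', h⟩
  have := Nat.le_findGreatest (hle _ hQ) hQ
  omega

lemma main_minors (p : ℕ) [Fact p.Prime] {n m : ℕ}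
    (F : Matrix (Fin n) (Fin m) (Polynomial ℤ))
    (d : ℕ) (hd : ∀ i j, (F i j).natDegree ≤ d) :
    ∃ (δ q : ℤ[X]) (K : Matrix (Fin m) (Fin m) ℤ[X]) (E : Matrix (Fin m) (Fin n) ℤ[X]),
      ¬ C (p:ℤ) ∣ δ ∧ q ≠ 0 ∧ F * K = 0 ∧ (∀ i j, (K i j).natDegree ≤ n * d) ∧
      q • (δ • 1 - K) = E * F := by
  classical
  obtain ⟨r, hr, ⟨a0, b0, hab0⟩, hmax⟩ := exists_max F
  have hpp : Prime (p:ℤ) := Nat.prime_iff_prime_int.mp Fact.out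
  have hp : Prime (C (p:ℤ)) := Polynomial.prime_C_iff.mpr hpp
  have hex : ∃ v, ∃ (a : Fin r → Fin n) (b : Fin r → Fin m),
      ¬ (C (p:ℤ))^(v+1) ∣ (F.submatrix a b).det := by
    obtain ⟨v, hv⟩ := FiniteMultiplicity.of_not_isUnit hp.not_isUnit hab0
    exact ⟨v, a0, b0, hv⟩
  have hall : ∀ (a : Fin r → Fin n) (b : Fin r → Fin m),
      (C (p:ℤ))^(Nat.find hex) ∣ (F.submatrix a b).det := by
    intro a b
    rcases Nat.eq_zero_or_pos (Nat.find hex) with h | h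
    · rw [h, pow_zero]; exact one_dvd _
    · have := Nat.find_min hex (Nat.sub_lt h one_pos)
      push Not at this
      have := this a b
      rwa [show Nat.find hex - 1 + 1 = Nat.find hex by omega] at this
  obtain ⟨a, b, hab⟩ := Nat.find_spec hex
  set v := Nat.find hex
  set q : ℤ[X] := (C (p:ℤ))^v with hq
  have hq0 : q ≠ 0 := pow_ne_zero _ hp.ne_zero
  obtain ⟨δ, hδ⟩ := hall a b
  have hdet0 : (F.submatrix a b).det ≠ 0 := fun h => hab (h ▸ dvd_zero _)
  -- the undivided matrix
  let K0 : Matrix (Fin m) (Fin m) ℤ[X] := Matrix.of fun j f =>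
    (F.submatrix a b).det * (if j = f then 1 else 0) -
      ∑ k, if b k = j then (F.submatrix a b).cramer (fun s => F (a s) f) k else 0
  have hK0 : ∀ j f, K0 j f = (F.submatrix a b).det * (if j = f then 1 else 0) -
      ∑ k, if b k = j then (F.submatrix a b).cramer (fun s => F (a s) f) k else 0 :=
    fun _ _ => rfl
  have hcr : ∀ f k, ∃ b' : Fin r → Fin m,
      (F.submatrix a b).cramer (fun s => F (a s) f) k = (F.submatrix a b').det := by
    intro f k
    refine ⟨Function.update b k f, ?_⟩
    rw [Matrix.cramer_apply]
    congr 1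
    ext1 x y
    by_cases h : y = k
    · subst h; simp
    · simp [h]
  have hdegm : ∀ (b' : Fin r → Fin m), (F.submatrix a b').det.natDegree ≤ n * d :=
    fun b' => det_deg _ hr fun i j => hd _ _
  have hK0q : ∀ j f, q ∣ K0 j f := by
    intro j f
    rw [hK0]
    refine dvd_sub (Dvd.dvd.mul_right (hall a b) _) (Finset.dvd_sum fun k _ => ?_)
    split_ifs
    · obtain ⟨b', hb'⟩ := hcr f k
      rw [hb']; exact hall a b'
    · exact dvd_zero _
  have hK0d : ∀ j f, (K0 j f).natDegree ≤ n * d := by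
    intro j f
    rw [hK0]
    refine (natDegree_sub_le_of_le (n := n * d) ?_
      (natDegree_sum_le_of_forall_le (n := n * d) _ _ fun k _ => ?_)).trans (max_self _).le
    · split_ifs
      · simpa using hdegm b
      · simp
    · split_ifs
      · obtain ⟨b', hb'⟩ := hcr f k
        rw [hb']; exact hdegm b'
      · simp
  choose K hK using hK0q
  have hK' : K0 = q • (Matrix.of K) := by
    ext1 i j; simpa using hK i j
  have hFK0 : F * K0 = 0 := by
    ext1 i f
    refine Eq.trans ?_ (cramer_sol F a b hdet0 hmax i f)
    simp only [Matrix.mul_apply, hK0, mul_sub, Finset.sum_sub_distrib, Finset.mul_sum]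
    congr 1
    · simp [mul_comm]
    · rw [Finset.sum_comm]
      simp
  refine ⟨δ, q, Matrix.of K, Matrix.of fun j i =>
    ∑ k, ∑ s, if b k = j ∧ a s = i then (F.submatrix a b).adjugate k s else 0, ?_, hq0, ?_, ?_, ?_⟩
  · intro ⟨c, hc⟩
    apply hab
    rw [hδ, hc, hq]
    exact ⟨c, by ring⟩
  · have : q • (F * Matrix.of K) = 0 := by
      rw [← Matrix.mul_smul, ← hK', hFK0]
    ext1 i j
    have := congrFun (congrFun this i) j
    simpa [hq0] using this
  · intro i j
    by_cases h0 : K i j = 0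
    · simp [h0]
    have h1 := hK0d i j
    rw [hK i j, natDegree_mul hq0 h0] at h1
    simp only [Matrix.of_apply]; omega
  · rw [smul_sub, ← hK', smul_smul, ← hδ]
    ext1 j f
    simp only [Matrix.sub_apply, Matrix.smul_apply, Matrix.one_apply, smul_eq_mul, hK0, sub_sub_cancel,
      Matrix.mul_apply, Matrix.of_apply, Finset.sum_mul, ite_mul, zero_mul]
    rw [Finset.sum_comm]
    refine Finset.sum_congr rfl fun k _ => ?_
    rw [Finset.sum_comm]
    rw [Matrix.cramer_eq_adjugate_mulVec]
    by_cases hb : b k = j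
    · simp [hb, Matrix.mulVec, dotProduct]
    · simp [hb]

lemma coprime_lift {R : Type*} [CommRing R] [IsLocalRing R] (δ g : R[X]) (hg : g.Monic)
    (h : IsCoprime (δ.map (IsLocalRing.residue R)) (g.map (IsLocalRing.residue R))) :
    IsCoprime δ g := by
  obtain ⟨a, b, hab⟩ := h
  obtain ⟨a, rfl⟩ := Polynomial.map_surjective _ IsLocalRing.residue_surjective a
  obtain ⟨b, rfl⟩ := Polynomial.map_surjective _ IsLocalRing.residue_surjective b
  have hc : ∀ i, (1 - (a * δ + b * g)).coeff i ∈ IsLocalRing.maximalIdeal R := by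
    intro i
    rw [← IsLocalRing.residue_eq_zero_iff, ← coeff_map]
    simp [hab]
  have : Module.Finite R (AdjoinRoot g) := hg.finite_adjoinRoot
  let N : Submodule R (AdjoinRoot g) :=
    (Ideal.span {AdjoinRoot.mk g δ}).restrictScalars R
  have hN : (⊤ : Submodule R (AdjoinRoot g)) ≤ N := by
    apply Submodule.le_of_le_smul_of_le_jacobson_bot Module.Finite.fg_top
      (IsLocalRing.maximalIdeal_le_jacobson _)
    intro y _
    obtain ⟨y, rfl⟩ := AdjoinRoot.mk_surjective y
    have e : AdjoinRoot.mk g y = AdjoinRoot.mk g δ * AdjoinRoot.mk g (a * y) +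
        AdjoinRoot.mk g ((1 - (a * δ + b * g)) * y) := by
      simp only [map_sub, map_add, map_mul, map_one, AdjoinRoot.mk_self]
      ring
    rw [e]
    refine Submodule.add_mem_sup ?_ ?_
    · exact Ideal.mul_mem_right _ _ (Ideal.mem_span_singleton_self _)
    · set c := 1 - (a * δ + b * g)
      rw [show c * y = (∑ i ∈ Finset.range (c.natDegree + 1), C (c.coeff i) * X ^ i) * y by
        rw [← c.as_sum_range_C_mul_X_pow]]
      rw [Finset.sum_mul, map_sum]
      refine Submodule.sum_mem _ fun i _ => ?_
      have : AdjoinRoot.mk g (C (c.coeff i) * X ^ i * y) = c.coeff i • AdjoinRoot.mk g (X^i*y) := by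
        rw [mul_assoc, map_mul, Algebra.smul_def]; rfl
      rw [this]
      exact Submodule.smul_mem_smul (hc i) trivial
  have h1 : (1 : AdjoinRoot g) ∈ Ideal.span {AdjoinRoot.mk g δ} := hN trivial
  obtain ⟨z, hz⟩ := Ideal.mem_span_singleton'.mp h1
  obtain ⟨z, rfl⟩ := AdjoinRoot.mk_surjective z
  rw [← map_mul, ← map_one (AdjoinRoot.mk g), eq_comm, AdjoinRoot.mk_eq_mk] at hz
  obtain ⟨w, hw⟩ := hz
  exact ⟨z, w, by linear_combination -hw⟩

lemma exists_coprime {R : Type*} [CommRing R] [IsLocalRing R] (δ : R[X])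
    (h : δ.map (IsLocalRing.residue R) ≠ 0) (T : ℕ) :
    ∃ g : R[X], g.Monic ∧ T < g.natDegree ∧ IsCoprime δ g := by
  set D := δ.map (IsLocalRing.residue R)
  have hdeg : (X ^ (T+1) * D + C 1).natDegree = T + 1 + D.natDegree := by
    rw [natDegree_add_C, natDegree_mul (pow_ne_zero _ X_ne_zero) h, natDegree_X_pow]
  set G := X ^ (T+1) * D + C 1
  have hG : G ≠ 0 := by rintro h0; simp [h0] at hdeg; omega
  have hl : G.leadingCoeff ≠ 0 := leadingCoeff_ne_zero.mpr hG
  have hlift : G * C G.leadingCoeff⁻¹ ∈ lifts (IsLocalRing.residue R) := by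
    rw [mem_lifts]; exact Polynomial.map_surjective _ IsLocalRing.residue_surjective _
  obtain ⟨g, hg, hgd, hgm⟩ := lifts_and_natDegree_eq_and_monic hlift (monic_mul_leadingCoeff_inv hG)
  refine ⟨g, hgm, ?_, ?_⟩
  · rw [hgd, natDegree_mul_C (inv_ne_zero hl), hdeg]; omega
  · apply coprime_lift _ _ hgm
    rw [hg]
    refine ⟨-X^(T+1), C G.leadingCoeff, ?_⟩
    have : C G.leadingCoeff * C G.leadingCoeff⁻¹ = 1 := by rw [← C_mul, mul_inv_cancel₀ hl, C_1]
    have e : G = X ^ (T+1) * D + 1 := by simp [G]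
    change -X^(T+1) * D + _ = _
    linear_combination G * this + e

/-- Division step. -/
lemma gen_step {R : Type*} [CommRing R] [IsLocalRing R] {m e : ℕ} (δ : R[X])
    (h : δ.map (IsLocalRing.residue R) ≠ 0)
    (M : Submodule R[X] (Fin m → R[X])) (Cv : Fin m → Fin m → R[X])
    (hC : ∀ f, Cv f ∈ M) (hCd : ∀ f j, (Cv f j).natDegree ≤ e)
    (Y : Fin m → R[X]) (hY : Y ∈ M) (hrel : δ • Y = ∑ f, Y f • Cv f) :
    Y ∈ Submodule.span R[X] {Z | Z ∈ M ∧ ∀ j, (Z j).natDegree ≤ e} := by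
  obtain ⟨g, hgm, hgd, a, b, hab⟩ := exists_coprime δ h (∑ j, (Y j).natDegree)
  let W : Fin m → R[X] := fun f => (a * Y f) %ₘ g
  let Q : Fin m → R[X] := fun f => (a * Y f) /ₘ g
  have hWQ : ∀ f, W f + g * Q f = a * Y f := fun f => modByMonic_add_div _ g
  let Z : Fin m → R[X] := b • Y + ∑ f, Q f • Cv f
  have hZM : Z ∈ M := M.add_mem (M.smul_mem _ hY) (M.sum_mem fun f _ => M.smul_mem _ (hC f))
  have hYe : Y = ∑ f, W f • Cv f + g • Z := by
    have : Y = a • (δ • Y) + g • (b • Y) := by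
      rw [smul_smul, smul_smul, ← add_smul, mul_comm g b, hab, one_smul]
    conv_lhs => rw [this]
    rw [hrel]
    simp only [Z, smul_add, Finset.smul_sum, smul_smul, ← hWQ, add_smul, Finset.sum_add_distrib]
    abel
  have hg1 : g ≠ 1 := by rintro rfl; simp at hgd
  have hZd : ∀ j, (Z j).natDegree ≤ e := by
    intro j
    by_cases hz : Z j = 0
    · simp [hz]
    have h1 : g * Z j = Y j - ∑ f, W f * Cv f j := by
      conv_rhs => rw [hYe]
      simp
    have h2 : (g * Z j).natDegree = g.natDegree + (Z j).natDegree := hgm.natDegree_mul' hz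
    have h3 : (g * Z j).natDegree ≤ g.natDegree + e := by
      rw [h1]
      refine (natDegree_sub_le_of_le (n := g.natDegree + e) ?_
        (natDegree_sum_le_of_forall_le (n := g.natDegree + e) _ _ fun f _ => ?_)).trans
        (max_self _).le
      · have := Finset.single_le_sum (f := fun j => (Y j).natDegree) (fun _ _ => Nat.zero_le _)
          (Finset.mem_univ j)
        omega
      · exact natDegree_mul_le.trans (Nat.add_le_add (natDegree_modByMonic_lt _ hgm hg1).le (hCd f j))
    omega
  rw [hYe]
  refine Submodule.add_mem _ (Submodule.sum_mem _ fun f _ => Submodule.smul_mem _ _ ?_)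
    (Submodule.smul_mem _ _ ?_)
  · exact Submodule.subset_span ⟨hC f, hCd f⟩
  · exact Submodule.subset_span ⟨hZM, hZd⟩

/-- clearing denominators -/
lemma clear_denoms (p : ℕ) [Fact p.Prime] {m e : ℕ} (Z : Fin m → (ZLoc p)[X])
    (hZ : ∀ j, (Z j).natDegree ≤ e) :
    ∃ (c : ZLoc p) (v : Fin m → ℤ[X]), IsUnit c ∧ (∀ j, (v j).natDegree ≤ e) ∧
      ∀ j, (v j).map (algebraMap ℤ (ZLoc p)) = C c * Z j := by
  obtain ⟨s, hs⟩ := IsLocalization.exist_integer_multiples_of_finite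
    (Ideal.span {(p : ℤ)}).primeCompl
    (fun x : Fin m × Fin (e+1) => (Z x.1).coeff x.2)
  choose w hw using hs
  refine ⟨algebraMap ℤ (ZLoc p) s, fun j => ∑ i : Fin (e+1), C (w (j, i)) * X ^ (i:ℕ),
    IsLocalization.map_units (ZLoc p) s, ?_, ?_⟩
  · intro j
    refine natDegree_sum_le_of_forall_le _ _ fun i _ => ?_
    exact (natDegree_C_mul_X_pow_le _ _).trans (by omega)
  · intro j
    conv_rhs => rw [(Z j).as_sum_range_C_mul_X_pow' (n := e+1) (by have := hZ j; omega)]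
    rw [Finset.sum_range, Finset.mul_sum, Polynomial.map_sum]
    refine Finset.sum_congr rfl fun i _ => ?_
    have := hw (j, i)
    simp only [Polynomial.map_mul, map_C, Polynomial.map_pow, map_X, this, Algebra.smul_def, C_mul,
      mul_assoc]

/-- Let p be a prime and F ∈ ℤ[x]^{n×m} with d = deg(F) the maximum degree
of its entries. Then the ℤ_(p)[x]-module Sol_{ℤ_(p)[x]}(F) = {Y ∈ ℤ_(p)[x]^m : FY = 0}
is generated by finitely many vectors lying in ℤ[x]^m whose entries have degree ≤ n·d. -/
theorem stmt11 (p : ℕ) [Fact p.Prime] {n m : ℕ}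
    (F : Matrix (Fin n) (Fin m) (Polynomial ℤ))
    (d : ℕ) (hd : ∀ i j, (F i j).natDegree ≤ d) :
    ∃ S : Finset (Fin m → Polynomial ℤ),
      (∀ v ∈ S, ∀ j, (v j).natDegree ≤ n * d) ∧
      ∀ Y : Fin m → Polynomial (ZLoc p),
        Y ∈ Submodule.span (Polynomial (ZLoc p))
          ((fun v : Fin m → Polynomial ℤ => fun j => (v j).map (algebraMap ℤ (ZLoc p))) ''
            (↑S : Set (Fin m → Polynomial ℤ))) ↔
        (F.map fun q => q.map (algebraMap ℤ (ZLoc p))).mulVec Y = 0 := by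
  classical
  have hinj : Function.Injective (algebraMap ℤ (ZLoc p)) :=
    IsLocalization.injective (M := (Ideal.span {(p : ℤ)}).primeCompl) _
      (Ideal.primeCompl_le_nonZeroDivisors _)
  let φ : ℤ[X] →+* (ZLoc p)[X] := mapRingHom (algebraMap ℤ (ZLoc p))
  have hφ : Function.Injective φ := Polynomial.map_injective _ hinj
  have : IsDomain (ZLoc p) := IsLocalization.isDomain_localization
    (Ideal.primeCompl_le_nonZeroDivisors _)
  have : IsNoetherianRing (ZLoc p) := IsLocalization.isNoetherianRing
    (Ideal.span {(p : ℤ)}).primeCompl _ inferInstance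
  change ∃ S : Finset (Fin m → ℤ[X]), _ ∧ ∀ Y, Y ∈ Submodule.span (ZLoc p)[X]
    ((fun v : Fin m → ℤ[X] => φ ∘ v) '' (↑S : Set (Fin m → ℤ[X]))) ↔ (F.map φ).mulVec Y = 0
  obtain ⟨δ, q, K, E, hδ, hq, hFK, hKd, hKE⟩ := main_minors p F d hd
  let M : Submodule (ZLoc p)[X] (Fin m → (ZLoc p)[X]) := LinearMap.ker (F.map φ).mulVecLin
  have hM : ∀ Y, Y ∈ M ↔ (F.map φ).mulVec Y = 0 := fun Y => Iff.rfl
  let T : Set (Fin m → ℤ[X]) := {v | F.mulVec v = 0 ∧ ∀ j, (v j).natDegree ≤ n * d}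
  have hTM : ∀ v, F.mulVec v = 0 → φ ∘ v ∈ M := by
    intro v hv
    rw [hM]
    ext1 i
    rw [← RingHom.map_mulVec, hv]; simp
  have hδ' : (φ δ).map (IsLocalRing.residue (ZLoc p)) ≠ 0 := by
    intro h0
    apply hδ
    rw [C_dvd_iff_dvd_coeff]
    intro i
    have := congrArg (fun f => f.coeff i) h0
    simp only [φ, coe_mapRingHom, coeff_map, coeff_zero] at this
    rw [IsLocalRing.residue_eq_zero_iff,
      IsLocalization.AtPrime.to_map_mem_maximal_iff (ZLoc p) (Ideal.span {(p : ℤ)})] at this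
    exact Ideal.mem_span_singleton.mp this
  have hspan : Submodule.span (ZLoc p)[X] ((fun v : Fin m → ℤ[X] => φ ∘ v) '' T) = M := by
    apply le_antisymm
    · rw [Submodule.span_le]
      rintro _ ⟨v, hv, rfl⟩
      exact hTM v hv.1
    · intro Y hY
      have h1 := gen_step (e := n * d) (φ δ) hδ' M (fun f => φ ∘ fun j => K j f) ?_ ?_ Y hY ?_
      · refine Submodule.span_le.mpr ?_ h1
        rintro Z ⟨hZM, hZd⟩
        obtain ⟨c, v, hc, hvd, hv⟩ := clear_denoms p Z hZd
        have hv' : φ ∘ v = C c • Z := by ext1 j; exact hv j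
        have hvT : v ∈ T := by
          refine ⟨?_, hvd⟩
          ext1 i
          apply hφ
          rw [RingHom.map_mulVec, hv', (hM _).mp (M.smul_mem _ hZM)]
          simp
        obtain ⟨c', hc'⟩ := hc.exists_left_inv
        have : Z = C c' • (φ ∘ v) := by
          rw [hv', smul_smul, ← C_mul, hc', C_1, one_smul]
        rw [this]
        exact Submodule.smul_mem _ _ (Submodule.subset_span ⟨v, hvT, rfl⟩)
      · intro f
        apply hTM
        ext1 i
        exact congrFun (congrFun hFK i) f
      · intro f j
        exact natDegree_map_le.trans (hKd j f)
      · have h2 := congrArg (fun N : Matrix (Fin m) (Fin m) ℤ[X] => (N.map φ).mulVec Y) hKE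
        simp only [Matrix.map_mul, ← Matrix.mulVec_mulVec, (hM Y).mp hY, Matrix.mulVec_zero] at h2
        have hq' : φ q ≠ 0 := by rwa [Ne, map_eq_zero_iff φ hφ]
        ext1 j
        have h3 := congrFun h2 j
        simp only [Matrix.mulVec, dotProduct, Matrix.map_apply, Matrix.smul_apply, Matrix.sub_apply,
          smul_eq_mul, map_mul, map_sub, mul_assoc, ← Finset.mul_sum, Pi.zero_apply, mul_eq_zero, hq',
          false_or, sub_mul, Finset.sum_sub_distrib, Matrix.one_apply] at h3
        have h4 := sub_eq_zero.mp h3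
        simp only [apply_ite φ, map_one, map_zero, ite_mul, one_mul, zero_mul, Finset.sum_ite_eq,
          Finset.mem_univ, if_true] at h4
        simp only [Pi.smul_apply, smul_eq_mul, Finset.sum_apply, Function.comp_apply, h4]
        exact Finset.sum_congr rfl fun _ _ => mul_comm _ _
  have hfg : (Submodule.span (ZLoc p)[X] ((fun v : Fin m → ℤ[X] => φ ∘ v) '' T)).FG :=
    IsNoetherian.noetherian _
  rw [Submodule.fg_span_iff_fg_span_finset_subset] at hfg
  obtain ⟨S', hS', hS'e⟩ := hfg
  obtain ⟨S, hST, hS⟩ := Finset.subset_set_image_iff.mp hS'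
  refine ⟨S, fun v hv => (hST hv).2, fun Y => ?_⟩
  rw [← hM, ← hspan, hS'e, ← hS, Finset.coe_image]
end

section
/- Let F ∈ ℤ[x]^{n×m} with d = deg(F) the maximum degree of its entries. Then the ℤ[x]-module Sol_{ℤ[x]}(F) = {Y ∈ ℤ[x]^m : FY = 0} is generated by a finite set of vectors, each of whose entries has degree at most n·d. -/
open Polynomial

/-- convex integer sequences -/
lemma convex_slope {g : ℕ → ℕ} (h0 : g 0 = 0) (hc : ∀ k, 2 * g (k+1) ≤ g k + g (k+2))
    {s c C K : ℕ} (hl : ∀ k, s * k ≤ g k + c) (hu : ∀ k, K ≤ k → g k ≤ s * k + C) :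
    ∀ k, c ≤ k → g (k+1) = g k + s := by
  have hm : ∀ k t, (g (k+1) : ℤ) - g k ≤ g (k+t+1) - g (k+t) := by
    intro k t
    induction t with
    | zero => simp
    | succ t ih =>
      have := hc (k+t)
      have e : k + t + 2 = k + (t+1) + 1 := by ring
      have e' : k + t + 1 = k + (t+1) := by ring
      rw [e, e'] at this
      rw [e'] at ih
      omega
  intro k hk
  apply le_antisymm
  · by_contra hlt
    push Not at hlt
    have : ∀ t : ℕ, (g k : ℤ) + (s+1) * t ≤ g (k+t) := by
      intro t
      induction t with
      | zero => simp
      | succ t ih =>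
        have := hm k t
        push_cast
        rw [← add_assoc k t 1]
        linarith [show (g k : ℤ) + s + 1 ≤ g (k+1) by exact_mod_cast hlt]
    have h1 := this (K + C + s * k + 1)
    have h2 := hu (k + (K + C + s * k + 1)) (by omega)
    zify at h2
    push_cast at h1 
    nlinarith [(Nat.cast_nonneg (g k) : (0:ℤ) ≤ _), (Nat.cast_nonneg K : (0:ℤ) ≤ _)]
  · by_contra hlt
    push Not at hlt
    have hb : ∀ j, j ≤ k + 1 → (g j : ℤ) ≤ (s - 1) * j := by
      intro j
      induction j with
      | zero => simp [h0]
      | succ j ih =>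
        intro hj
        have i1 := ih (by omega)
        have := hm j (k - j)
        rw [show j + (k - j) = k by omega] at this
        push_cast
        linarith [show (g (k+1) : ℤ) + 1 ≤ g k + s by exact_mod_cast hlt]
    have h1 := hb (k+1) le_rfl
    have h2 := hl (k+1)
    zify at h2 hk
    push_cast at h1
    linarith

lemma convex_eventually {g : ℕ → ℕ} (hc : ∀ k, 2 * g (k+1) ≤ g k + g (k+2)) (hmono : ∀ k, g k ≤ g (k+1))
    {m : ℕ} (hu : ∀ k, g k ≤ m * k) : ∃ k0 s, ∀ k, k0 ≤ k → g (k+1) = g k + s := by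
  have hs : Monotone (fun k => g (k+1) - g k) := by
    apply monotone_nat_of_le_succ
    intro k
    have := hc k; have := hmono k; have := hmono (k+1)
    show g (k+1) - g k ≤ g (k+1+1) - g (k+1)
    have e : k + 2 = k + 1 + 1 := rfl
    rw [e] at *
    omega
  have hbd : ∀ k, g (k+1) - g k ≤ m := by
    intro k
    by_contra hlt
    push Not at hlt
    have : ∀ t : ℕ, (m+1) * t ≤ g (k+t) := by
      intro t
      induction t with
      | zero => simp
      | succ t ih =>
        have h1 : g (k+1) - g k ≤ g (k+t+1) - g (k+t) := hs (show k ≤ k+t by omega)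
        have := hmono (k+t)
        rw [← add_assoc k t 1, mul_add]
        omega
    have h1 := this (m * k + 1)
    have h2 := hu (k + (m*k+1))
    nlinarith
  have hfin : (Set.range (fun k => g (k+1) - g k)).Finite :=
    (Set.finite_Iic m).subset (by rintro _ ⟨k, rfl⟩; exact hbd k)
  obtain ⟨x, ⟨k0, hk0⟩, hx⟩ := hfin.exists_maximal (Set.range_nonempty _)
  refine ⟨k0, g (k0+1) - g k0, fun k hk => ?_⟩
  have h1 : g (k0+1) - g k0 ≤ g (k+1) - g k := hs hk
  have h2 := hx ⟨k, rfl⟩ (by rw [← hk0]; exact h1)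
  have := hmono k
  simp only at hk0 h2
  omega

/-- convexity of ranks -/
lemma rank_convex {R E : Type*} [CommRing R] [IsDomain R] [AddCommGroup E] [Module R E]
    (T : E →ₗ[R] E) (hT : Function.Injective T) (A B D : Submodule R E)
    [Module.Finite R A] [Module.Finite R B] [Module.Finite R D]
    (hBD : B ≤ D) (hTBD : B.map T ≤ D) (hsat : ∀ w, w ∈ B → T w ∈ B → w ∈ A) [IsNoetherianRing R] :
    2 * Module.finrank R B ≤ Module.finrank R A + Module.finrank R D ∧
    2 * Module.finrank R B ≤ Module.finrank R A + Module.finrank R (B ⊔ B.map T : Submodule R E) := by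
  have e : Module.finrank R (B.map T) = Module.finrank R B :=
    (Submodule.equivMapOfInjective T hT B).finrank_eq.symm
  have e2 : Module.finrank R (A.map T) = Module.finrank R A :=
    (Submodule.equivMapOfInjective T hT A).finrank_eq.symm
  have : Module.Finite R (B ⊓ B.map T : Submodule R E) :=
    Module.Finite.of_injective (Submodule.inclusion inf_le_left) (Submodule.inclusion_injective _)
  have e3 : Module.finrank R (B ⊔ B.map T : Submodule R E) + Module.finrank R (B ⊓ B.map T : Submodule R E) = 
     Module.finrank R B + Module.finrank R (B.map T) := by
    have := Submodule.rank_sup_add_rank_inf_eq B (B.map T)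
    rw [← Module.finrank_eq_rank, ← Module.finrank_eq_rank, ← Module.finrank_eq_rank, ← Module.finrank_eq_rank] at this
    exact_mod_cast this
  have h4 : Module.finrank R (B ⊓ B.map T : Submodule R E) ≤ Module.finrank R (A.map T) := by
    apply Submodule.finrank_mono
    rintro v ⟨hv, w, hw, rfl⟩
    exact ⟨w, hsat w hw hv, rfl⟩
  have h5 : Module.finrank R (B ⊔ B.map T : Submodule R E) ≤ Module.finrank R D :=
    Submodule.finrank_mono (sup_le hBD hTBD)
  omega

/-- The saturation of the sequence `V`. -/
def satSeq {K E : Type*} [Field K] [AddCommGroup E] [Module K E]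
    (T : E →ₗ[K] E) (V : ℕ → Submodule K E) (k : ℕ) : Submodule K E where
  carrier := {w | ∃ t0, ∀ t, t0 ≤ t → ∀ i, i ≤ t → (T ^ i) w ∈ V (k + t)}
  zero_mem' := ⟨0, fun t _ i _ => by simp⟩
  add_mem' := by
    rintro a b ⟨t1, h1⟩ ⟨t2, h2⟩
    refine ⟨max t1 t2, fun t ht i hi => ?_⟩
    rw [map_add]
    exact add_mem (h1 t (by omega) i hi) (h2 t (by omega) i hi)
  smul_mem' := by
    rintro c a ⟨t1, h1⟩
    refine ⟨t1, fun t ht i hi => ?_⟩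
    rw [map_smul]
    exact Submodule.smul_mem _ _ (h1 t ht i hi)

lemma gen_le {K E : Type*} [Field K] [AddCommGroup E] [Module K E]
    (T : E →ₗ[K] E) (G : ℕ → Submodule K E) (j : ℕ)
    (hG : ∀ k, j ≤ k → G (k+1) ≤ G k ⊔ (G k).map T) :
    ∀ t (N : Submodule K E), (∀ i, i ≤ t → ∀ w ∈ G j, (T ^ i) w ∈ N) → G (j+t) ≤ N := by
  intro t
  induction t with
  | zero => intro N h w hw; simpa using h 0 le_rfl w hw
  | succ t ih =>
    intro N h
    refine (hG (j+t) (by omega)).trans (sup_le (ih N fun i hi => h i (by omega)) ?_)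
    rw [Submodule.map_le_iff_le_comap]
    refine ih _ fun i hi w hw => ?_
    have := h (i+1) (by omega) w hw
    rw [pow_succ'] at this
    exact this

lemma field_step {K E : Type*} [Field K] [AddCommGroup E] [Module K E]
    (T : E →ₗ[K] E) (hT : Function.Injective T) (V D : ℕ → Submodule K E)
    (hV : ∀ k, V k ≤ V (k+1)) (hTV : ∀ k, ∀ w ∈ V k, T w ∈ V (k+1))
    (hVD : ∀ k, V k ≤ D k) (hD : ∀ k w, T w ∈ D (k+1) → w ∈ D k)
    [∀ k, Module.Finite K (D k)] (m s c C : ℕ) (hDm : ∀ k, Module.finrank K (D k) ≤ m * k)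
    (hl : ∀ k, s * k ≤ Module.finrank K (V k) + c)
    (hu : ∀ k, Module.finrank K (V k) ≤ s * k + C)
    (hs : ∀ k, c ≤ k → Module.finrank K (V (k+1)) = Module.finrank K (V k) + s) :
    ∀ k, c + 1 ≤ k → V (k+1) ≤ V k ⊔ (V k).map T := by
  set G := satSeq T V with hGdef
  have hmem : ∀ k w, w ∈ G k ↔ ∃ t, ∀ i, i ≤ t → (T ^ i) w ∈ V (k + t) := by
    intro k w
    refine ⟨fun ⟨t, h⟩ => ⟨t, h t le_rfl⟩, fun ⟨t, h⟩ => ⟨t, fun t' ht' => ?_⟩⟩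
    induction t', ht' using Nat.le_induction with
    | base => exact h
    | succ t' ht' ih =>
      intro i hi
      rcases Nat.lt_or_ge i (t'+1) with h1 | h1
      · exact hV _ (ih i (by omega))
      · obtain rfl : i = t' + 1 := by omega
        rw [pow_succ']
        exact hTV _ _ (ih t' le_rfl)
  have hVG : ∀ k, V k ≤ G k := fun k w hw => (hmem k w).2 ⟨0, fun i hi => by
    obtain rfl : i = 0 := by omega
    simpa using hw⟩
  have hDt : ∀ t k w, (T ^ t) w ∈ D (k + t) → w ∈ D k := by
    intro t
    induction t with
    | zero => intro k w h; simpa using h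
    | succ t ih =>
      intro k w h
      rw [pow_succ'] at h
      exact ih k w (hD _ _ h)
  have hGD : ∀ k, G k ≤ D k := fun k w hw => by
    obtain ⟨t, h⟩ := (hmem k w).1 hw
    exact hDt t k w (hVD _ (h t le_rfl))
  have fG : ∀ k, Module.Finite K (G k) := fun k =>
    Module.Finite.of_injective (Submodule.inclusion (hGD k)) (Submodule.inclusion_injective _)
  have fV : ∀ k, Module.Finite K (V k) := fun k =>
    Module.Finite.of_injective (Submodule.inclusion (hVD k)) (Submodule.inclusion_injective _)
  have hG : ∀ k, G k ≤ G (k+1) := fun k w hw => by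
    obtain ⟨t, h⟩ := (hmem k w).1 hw
    refine (hmem _ w).2 ⟨t, fun i hi => ?_⟩
    rw [show k + 1 + t = k + t + 1 by ring]
    exact hV _ (h i hi)
  have hTG : ∀ k, (G k).map T ≤ G (k+1) := by
    rintro k _ ⟨w, hw, rfl⟩
    obtain ⟨t, h⟩ := (hmem k w).1 hw
    refine (hmem _ _).2 ⟨t, fun i hi => ?_⟩
    rw [show k + 1 + t = k + t + 1 by ring]
    have := hTV _ _ (h i hi)
    have e : T ((T ^ i) w) = (T ^ i) (T w) := by
      rw [← Module.End.mul_apply, ← Module.End.mul_apply, ← pow_succ', pow_succ]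
    rw [← e]; exact this
  have hsat : ∀ k w, w ∈ G (k+1) → T w ∈ G (k+1) → w ∈ G k := by
    rintro k w ⟨t1, h1⟩ ⟨t2, h2⟩
    refine (hmem _ _).2 ⟨max t1 t2 + 1, fun i hi => ?_⟩
    rw [show k + (max t1 t2 + 1) = k + 1 + max t1 t2 by ring]
    rcases i with _ | i
    · exact h1 _ (by omega) 0 (by omega)
    · rw [pow_succ]
      exact h2 _ (by omega) i (by omega)
  have hconv := fun k => rank_convex T hT (G k) (G (k+1)) (G (k+2)) (hG _) (hTG _) (hsat k)
  have key : ∀ k, Module.finrank K (G (k+2)) + Module.finrank K (G k) ≤ 2 * Module.finrank K (G (k+1)) →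
      G (k+2) ≤ G (k+1) ⊔ (G (k+1)).map T := by
    intro k h
    have hle : G (k+1) ⊔ (G (k+1)).map T ≤ G (k+2) := sup_le (hG _) (hTG _)
    exact (Submodule.eq_of_le_of_finrank_le hle (by have := (hconv k).2; omega)).ge
  have hgm : ∀ k, Module.finrank K (G k) ≤ m * k := fun k =>
    (Submodule.finrank_mono (hGD k)).trans (hDm k)
  have hVg : ∀ k, Module.finrank K (V k) ≤ Module.finrank K (G k) := fun k =>
    Submodule.finrank_mono (hVG k)
  obtain ⟨k0, s', hk0⟩ := convex_eventually (g := fun k => Module.finrank K (G k))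
    (fun k => (hconv k).1) (fun k => Submodule.finrank_mono (hG k)) hgm
  have hgen : ∀ k, k0 + 1 ≤ k → G (k+1) ≤ G k ⊔ (G k).map T := by
    intro k hk
    obtain ⟨k, rfl⟩ : ∃ l, k = l + 1 := ⟨k-1, by omega⟩
    apply key
    have h1 := hk0 k (by omega)
    have h2 := hk0 (k+1) (by omega)
    beta_reduce at h1 h2
    rw [show k + 2 = k + 1 + 1 from rfl]
    omega
  have hev : ∃ K0, ∀ k, K0 ≤ k → G k ≤ V k := by
    have : ∃ t0, ∀ t, t0 ≤ t → ∀ i, i ≤ t → ∀ w ∈ G (k0+1), (T ^ i) w ∈ V (k0 + 1 + t) := by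
      have hfg : (G (k0+1)).FG := Module.Finite.iff_fg.1 (fG _)
      obtain ⟨S, hS⟩ := hfg
      have hSG : ∀ w ∈ S, w ∈ G (k0+1) := fun w hw => hS ▸ Submodule.subset_span hw
      choose! f hf using hSG
      refine ⟨S.sup f, fun t ht i hi => ?_⟩
      have : G (k0+1) ≤ (V (k0+1+t)).comap (T ^ i) := by
        rw [← hS, Submodule.span_le]
        intro w hw
        exact hf w hw t ((Finset.le_sup (f := f) hw).trans ht) i hi
      exact this
    obtain ⟨t0, h⟩ := this
    refine ⟨k0 + 1 + t0, fun k hk => ?_⟩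
    obtain ⟨t, rfl⟩ : ∃ t, k = k0 + 1 + t := ⟨k - (k0+1), by omega⟩
    exact gen_le T G (k0+1) hgen t _ (h t (by omega))
  obtain ⟨K0, hK0⟩ := hev
  have hslope := convex_slope (g := fun k => Module.finrank K (G k)) (by simpa using hgm 0)
    (fun k => (hconv k).1) (s := s) (c := c) (C := C) (K := K0)
    (fun k => (hl k).trans (by have := hVg k; omega))
    (fun k hk => (Submodule.finrank_mono (hK0 k hk)).trans (hu k))
  beta_reduce at hslope
  have hd : ∀ t k, c ≤ k → Module.finrank K (G (k+t)) + Module.finrank K (V k)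
      = Module.finrank K (V (k+t)) + Module.finrank K (G k) := by
    intro t k hk
    induction t with
    | zero => simp [add_comm]
    | succ t ih =>
      have h1 := hslope (k+t) (by omega)
      have h2 := hs (k+t) (by omega)
      rw [← add_assoc k t 1]
      omega
  have heq : ∀ k, c ≤ k → V k = G k := by
    intro k hk
    apply Submodule.eq_of_le_of_finrank_le (hVG k)
    have h1 := hd K0 k hk
    have h2 := Submodule.finrank_mono (hK0 (k+K0) (by omega))
    omega
  intro k hk
  rw [heq k (by omega), heq (k+1) (by omega)]
  obtain ⟨k, rfl⟩ : ∃ l, k = l + 1 := ⟨k-1, by omega⟩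
  apply key
  have h1 := hslope k (by omega)
  have h2 := hslope (k+1) (by omega)
  rw [show k + 2 = k + 1 + 1 from rfl]
  omega

/-- vectors of polynomials of degree `< k` -/
noncomputable def DD (R : Type*) [CommRing R] (ι : Type*) (k : ℕ) : Submodule R (ι → R[X]) :=
  Submodule.pi Set.univ (fun _ => degreeLT R k)

lemma mem_DD {R : Type*} [CommRing R] {ι : Type*} {k : ℕ} {w : ι → R[X]} :
    w ∈ DD R ι k ↔ ∀ j i, k ≤ i → (w j).coeff i = 0 := by
  simp [DD, Submodule.mem_pi, mem_degreeLT, degree_lt_iff_coeff_zero]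

/-- `DD` is free -/
noncomputable def DDequiv (R : Type*) [CommRing R] (ι : Type*) (k : ℕ) : DD R ι k ≃ₗ[R] (ι → degreeLT R k) where
  toFun w j := ⟨w.1 j, w.2 j trivial⟩
  invFun f := ⟨fun j => f j, fun j _ => (f j).2⟩
  map_add' _ _ := rfl
  map_smul' _ _ := rfl
  left_inv _ := rfl
  right_inv _ := rfl

instance DDfinite (R : Type*) [CommRing R] (ι : Type*) [Finite ι] (k : ℕ) : Module.Finite R (DD R ι k) :=
  have : Module.Finite R (degreeLT R k) := Module.Finite.equiv (degreeLTEquiv R k).symm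
  Module.Finite.equiv (DDequiv R ι k).symm

lemma DDfinrank (R : Type*) [CommRing R] [Nontrivial R] (ι : Type*) [Fintype ι] (k : ℕ) :
    Module.finrank R (DD R ι k) = Fintype.card ι * k := by
  rw [((DDequiv R ι k).trans (LinearEquiv.piCongrRight fun _ => degreeLTEquiv R k)).finrank_eq]
  rw [Module.finrank_pi_fintype]
  simp

/-- multiplication by `X` -/
noncomputable def TX (R : Type*) [CommRing R] (ι : Type*) : (ι → R[X]) →ₗ[R] (ι → R[X]) where
  toFun w j := X * w j
  map_add' a b := by ext1 j; simp [mul_add]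
  map_smul' a b := by ext1 j; simp

lemma TX_inj (R : Type*) [CommRing R] (ι : Type*) : Function.Injective (TX R ι) := by
  intro a b h
  ext j i
  have := congrArg (fun q => (q j).coeff (i+1)) h
  simpa [TX] using this

lemma TX_DD {R : Type*} [CommRing R] {ι : Type*} {k : ℕ} {w : ι → R[X]} :
    TX R ι w ∈ DD R ι (k+1) ↔ w ∈ DD R ι k := by
  rw [mem_DD, mem_DD]
  constructor
  · intro h j i hi
    simpa [TX] using h j (i+1) (by omega)
  · intro h j i hi
    obtain ⟨i, rfl⟩ : ∃ l, i = l + 1 := ⟨i-1, by omega⟩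
    simpa [TX] using h j i (by omega)

lemma DD_mono {R : Type*} [CommRing R] {ι : Type*} {k l : ℕ} (h : k ≤ l) : DD R ι k ≤ DD R ι l := by
  intro w hw
  rw [mem_DD] at *
  exact fun j i hi => hw j i (by omega)

lemma mulVec_DD {ι κ : Type*} [Fintype κ] (F : Matrix ι κ ℤ[X]) {d k : ℕ}
    (hd : ∀ i j, (F i j).natDegree ≤ d) {w : κ → ℤ[X]} (hw : w ∈ DD ℤ κ k) :
    F.mulVec w ∈ DD ℤ ι (k + d) := by
  rw [mem_DD] at *
  intro i l hl
  simp only [Matrix.mulVec, dotProduct, finsetSum_coeff]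
  refine Finset.sum_eq_zero fun j _ => ?_
  rw [coeff_mul]
  refine Finset.sum_eq_zero fun a ha => ?_
  rw [Finset.HasAntidiagonal.mem_antidiagonal] at ha
  rcases Nat.lt_or_ge d a.1 with h | h
  · rw [coeff_eq_zero_of_natDegree_lt ((hd i j).trans_lt h), zero_mul]
  · rw [hw j a.2 (by omega), mul_zero]

/-- solutions of degree `< k` -/
noncomputable def MM {ι κ : Type*} [Fintype κ] (F : Matrix ι κ ℤ[X]) (k : ℕ) : Submodule ℤ (κ → ℤ[X]) :=
  DD ℤ κ k ⊓ (LinearMap.ker F.mulVecLin).restrictScalars ℤ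

lemma mem_MM {ι κ : Type*} [Fintype κ] {F : Matrix ι κ ℤ[X]} {k : ℕ} {w : κ → ℤ[X]} :
    w ∈ MM F k ↔ w ∈ DD ℤ κ k ∧ F.mulVec w = 0 := by
  simp [MM]

instance MMfinite {ι κ : Type*} [Fintype κ] (F : Matrix ι κ ℤ[X]) (k : ℕ) : Module.Finite ℤ (MM F k) :=
  Module.Finite.of_injective (Submodule.inclusion (inf_le_left : MM F k ≤ DD ℤ κ k))
    (Submodule.inclusion_injective _)

lemma TX_ker {ι κ : Type*} [Fintype κ] (F : Matrix ι κ ℤ[X]) (w : κ → ℤ[X]) :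
    F.mulVec (TX ℤ κ w) = 0 ↔ F.mulVec w = 0 := by
  have : TX ℤ κ w = (X : ℤ[X]) • w := rfl
  rw [this, Matrix.mulVec_smul]
  simp

lemma MM_mono {ι κ : Type*} [Fintype κ] (F : Matrix ι κ ℤ[X]) {k l : ℕ} (h : k ≤ l) : MM F k ≤ MM F l :=
  inf_le_inf_right _ (DD_mono h)

lemma TX_MM {ι κ : Type*} [Fintype κ] {F : Matrix ι κ ℤ[X]} {k : ℕ} {w : κ → ℤ[X]} :
    TX ℤ κ w ∈ MM F (k+1) ↔ w ∈ MM F k := by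
  rw [mem_MM, mem_MM, TX_DD, TX_ker]

lemma MM_convex {ι κ : Type*} [Fintype κ] (F : Matrix ι κ ℤ[X]) (k : ℕ) :
    2 * Module.finrank ℤ (MM F (k+1)) ≤ Module.finrank ℤ (MM F k) + Module.finrank ℤ (MM F (k+2)) :=
  (rank_convex (TX ℤ κ) (TX_inj _ _) (MM F k) (MM F (k+1)) (MM F (k+2)) (MM_mono F (by omega))
    (by rintro _ ⟨w, hw, rfl⟩; exact TX_MM.2 hw) (fun w _ h => TX_MM.1 h)).1

lemma MM_lower {ι κ : Type*} [Fintype κ] [Fintype ι] (F : Matrix ι κ ℤ[X]) {d : ℕ}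
    (hd : ∀ i j, (F i j).natDegree ≤ d) (k : ℕ) :
    Fintype.card κ * k ≤ Module.finrank ℤ (MM F k) + Fintype.card ι * (k + d) := by
  let f : DD ℤ κ k →ₗ[ℤ] DD ℤ ι (k+d) :=
    LinearMap.codRestrict _ ((F.mulVecLin.restrictScalars ℤ).domRestrict (DD ℤ κ k))
      (fun w => mulVec_DD F hd w.2)
  have h := Submodule.finrank_quotient_add_finrank (LinearMap.ker f)
  rw [DDfinrank, f.quotKerEquivRange.finrank_eq] at h
  have h1 : Module.finrank ℤ (LinearMap.range f) ≤ Fintype.card ι * (k+d) := by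
    rw [← DDfinrank ℤ ι (k+d)]
    exact Submodule.finrank_le _
  have h2 : Module.finrank ℤ (LinearMap.ker f) ≤ Module.finrank ℤ (MM F k) := by
    let g : LinearMap.ker f →ₗ[ℤ] MM F k :=
      LinearMap.codRestrict _ ((DD ℤ κ k).subtype ∘ₗ (LinearMap.ker f).subtype) (fun w => by
        refine mem_MM.2 ⟨w.1.2, ?_⟩
        have := congrArg Subtype.val w.2
        exact this)
    apply LinearMap.finrank_le_finrank_of_injective (f := g)
    intro a b h
    have := congrArg Subtype.val h
    exact Subtype.ext (Subtype.ext this)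
  omega

lemma exists_rinv {ι κ : Type*} [Fintype κ] [Fintype ι] [DecidableEq ι] (F : Matrix ι κ ℤ[X])
    (hF : LinearIndependent ℤ[X] F.row) :
    ∃ (B : Matrix κ ι ℤ[X]) (δ : ℤ[X]), δ ≠ 0 ∧ F * B = δ • (1 : Matrix ι ι ℤ[X]) := by
  refine ⟨F.transpose * (F * F.transpose).adjugate, (F * F.transpose).det, ?_, ?_⟩
  · intro h0
    obtain ⟨v, hv, h⟩ := Matrix.exists_vecMul_eq_zero_iff.2 h0
    apply hv
    have h1 : dotProduct (Matrix.vecMul v F) (Matrix.vecMul v F) = 0 := by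
      rw [← Matrix.vecMul_vecMul] at h
      have := congrArg (fun u => dotProduct u v) h
      simp only [zero_dotProduct] at this
      rw [← this, ← Matrix.dotProduct_mulVec, Matrix.vecMul_transpose, dotProduct_comm]
    have h2 : Matrix.vecMul v F = 0 := by
      ext1 j
      apply Polynomial.funext
      intro a
      have := congrArg (eval a) h1
      simp only [dotProduct, eval_finsetSum, eval_mul, eval_zero] at this
      rw [Finset.sum_eq_zero_iff_of_nonneg (fun i _ => mul_self_nonneg _)] at this
      simpa using this j (Finset.mem_univ _)
    have hF := Fintype.linearIndependent_iff.1 hF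
    ext1 i
    refine hF v ?_ i
    rw [← h2]
    ext1 j
    simp [Matrix.vecMul, dotProduct]
  · rw [← Matrix.mul_assoc, Matrix.mul_adjugate]

lemma exists_deg {ι κ : Type*} [Finite κ] [Finite ι] (B : Matrix κ ι ℤ[X]) :
    ∃ C, ∀ i j, (B i j).natDegree ≤ C := by
  have := Fintype.ofFinite κ
  have := Fintype.ofFinite ι
  refine ⟨Finset.univ.sup fun i => Finset.univ.sup fun j => (B i j).natDegree, fun i j => ?_⟩
  exact (Finset.le_sup (f := fun j => (B i j).natDegree) (Finset.mem_univ j)).trans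
    (Finset.le_sup (f := fun i => Finset.univ.sup fun j => (B i j).natDegree) (Finset.mem_univ i))

lemma MM_upper {ι κ : Type*} [Fintype κ] [Fintype ι] (F : Matrix ι κ ℤ[X])
    (hF : LinearIndependent ℤ[X] F.row) : ∃ C, ∀ k,
    Fintype.card ι * k + Module.finrank ℤ (MM F (k + C)) ≤ Fintype.card κ * (k + C) := by
  classical
  obtain ⟨B, δ, hδ, hB⟩ := exists_rinv F hF
  obtain ⟨C, hC⟩ := exists_deg B
  refine ⟨C, fun k => ?_⟩
  let f1 : DD ℤ ι k →ₗ[ℤ] DD ℤ κ (k+C) :=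
    LinearMap.codRestrict _ ((B.mulVecLin.restrictScalars ℤ).domRestrict (DD ℤ ι k))
      (fun w => mulVec_DD B hC w.2)
  let f2 : MM F (k+C) →ₗ[ℤ] DD ℤ κ (k+C) := Submodule.inclusion inf_le_left
  have hinj : Function.Injective (f1.coprod f2) := by
    rw [injective_iff_map_eq_zero]
    rintro ⟨z, u⟩ h
    have h' : B.mulVec z.1 + u.1 = 0 := congrArg Subtype.val h
    have h1 := congrArg F.mulVec h'
    rw [Matrix.mulVec_add, (mem_MM.1 u.2).2, Matrix.mulVec_mulVec, hB, Matrix.smul_mulVec,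
      Matrix.one_mulVec, Matrix.mulVec_zero, add_zero] at h1
    have hz : z.1 = 0 := (smul_eq_zero.1 h1).resolve_left hδ
    have hu : u.1 = 0 := by simpa [hz] using h'
    exact Prod.ext (Subtype.ext hz) (Subtype.ext hu)
  have := LinearMap.finrank_le_finrank_of_injective hinj
  rwa [Module.finrank_prod, DDfinrank, DDfinrank] at this

/-- reduction mod `p` -/
noncomputable def red (p : ℕ) {κ : Type*} : (κ → ℤ[X]) →ₗ[ℤ] (κ → (ZMod p)[X]) where
  toFun w j := (w j).map (Int.castRingHom (ZMod p))
  map_add' a b := by ext1 j; simp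
  map_smul' a b := by ext1 j; simp

lemma red_coeff (p : ℕ) {κ : Type*} (w : κ → ℤ[X]) (j : κ) (i : ℕ) :
    (red p w j).coeff i = ((w j).coeff i : ZMod p) := by
  simp [red]

lemma red_TX (p : ℕ) {κ : Type*} (w : κ → ℤ[X]) : red p (TX ℤ κ w) = TX (ZMod p) κ (red p w) := by
  ext1 j
  simp [red, TX]

lemma red_eq_zero (p : ℕ) {κ : Type*} {w : κ → ℤ[X]} (h : red p w = 0) :
    ∃ y : κ → ℤ[X], w = (p : ℤ) • y := by
  have : ∀ j, ∃ q : ℤ[X], w j = C (p : ℤ) * q := by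
    intro j
    change C (p : ℤ) ∣ w j
    rw [C_dvd_iff_dvd_coeff]
    intro i
    rw [← ZMod.intCast_zmod_eq_zero_iff_dvd, ← red_coeff, h]
    simp
  choose y hy using this
  refine ⟨y, ?_⟩
  ext1 j
  rw [hy j, Pi.smul_apply, smul_eq_C_mul]

lemma MM_sat {ι κ : Type*} [Fintype κ] {F : Matrix ι κ ℤ[X]} {k : ℕ} {p : ℤ} (hp : p ≠ 0)
    {y : κ → ℤ[X]} (h : p • y ∈ MM F k) : y ∈ MM F k := by
  rw [mem_MM, mem_DD] at *
  refine ⟨fun j i hi => ?_, ?_⟩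
  · have := h.1 j i hi
    simpa [hp] using this
  · have := h.2
    rw [Matrix.mulVec_smul] at this
    exact (smul_eq_zero.1 this).resolve_left hp

lemma red_smul (p : ℕ) {κ : Type*} (c : ℤ) (w : κ → ℤ[X]) :
    red p (c • w) = (c : ZMod p) • red p w := by
  ext j i
  simp [red]

/-- image of the solutions mod `p` -/
noncomputable def VV (p : ℕ) [NeZero p] {ι κ : Type*} [Fintype κ] (F : Matrix ι κ ℤ[X]) (k : ℕ) :
    Submodule (ZMod p) (κ → (ZMod p)[X]) where
  carrier := {v | ∃ w ∈ MM F k, red p w = v}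
  zero_mem' := ⟨0, zero_mem _, map_zero _⟩
  add_mem' := by
    rintro _ _ ⟨a, ha, rfl⟩ ⟨b, hb, rfl⟩
    exact ⟨a + b, add_mem ha hb, map_add _ _ _⟩
  smul_mem' := by
    rintro c _ ⟨a, ha, rfl⟩
    refine ⟨(c.val : ℤ) • a, Submodule.smul_mem _ _ ha, ?_⟩
    rw [red_smul]
    simp

lemma mem_VV {p : ℕ} [NeZero p] {ι κ : Type*} [Fintype κ] {F : Matrix ι κ ℤ[X]} {k : ℕ}
    {v : κ → (ZMod p)[X]} : v ∈ VV p F k ↔ ∃ w ∈ MM F k, red p w = v := Iff.rfl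

lemma VV_finrank (p : ℕ) [Fact p.Prime] {ι κ : Type*} [Fintype κ] (F : Matrix ι κ ℤ[X]) (k : ℕ) :
    Module.finrank (ZMod p) (VV p F k) = Module.finrank ℤ (MM F k) := by
  have hp : (p : ℤ) ≠ 0 := by exact_mod_cast (Fact.out : p.Prime).ne_zero
  let b := Module.finBasis ℤ (MM F k)
  let v : Fin (Module.finrank ℤ (MM F k)) → VV p F k := fun i => ⟨red p (b i).1, (b i).1, (b i).2, rfl⟩
  have hsum : ∀ c : Fin (Module.finrank ℤ (MM F k)) → ℤ,
      ((∑ i, (c i : ZMod p) • v i : VV p F k) : κ → (ZMod p)[X]) = red p (∑ i, c i • b i : MM F k).1 := by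
    intro c
    simp only [AddSubmonoidClass.coe_finsetSum, map_sum, Submodule.coe_smul, red_smul, v]
  have li : LinearIndependent (ZMod p) v := by
    rw [Fintype.linearIndependent_iff]
    intro c hc i
    choose e he using fun i => ZMod.intCast_surjective (c i)
    have h1 := hsum e
    simp only [he, hc] at h1
    obtain ⟨y, hy⟩ := red_eq_zero p (h1.symm)
    have hyM : y ∈ MM F k := MM_sat hp (hy ▸ (Subtype.mem _))
    have h2 : (∑ i, e i • b i : MM F k) = (p : ℤ) • ⟨y, hyM⟩ := Subtype.ext hy
    have h3 := congrArg (fun u => b.repr u i) h2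
    simp only [Module.Basis.repr_sum_self, map_smul, Finsupp.smul_apply, smul_eq_mul] at h3
    have h4 := congrArg (Int.cast : ℤ → ZMod p) h3
    simpa [he] using h4
  have sp : ⊤ ≤ Submodule.span (ZMod p) (Set.range v) := by
    rintro ⟨_, w, hw, rfl⟩ -
    have h1 := hsum (fun i => b.repr ⟨w, hw⟩ i)
    rw [b.sum_repr] at h1
    have h2 : (⟨red p w, w, hw, rfl⟩ : VV p F k) = ∑ i, ((b.repr ⟨w, hw⟩ i : ℤ) : ZMod p) • v i :=
      Subtype.ext h1.symm
    rw [h2]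
    exact Submodule.sum_mem _ fun i _ => Submodule.smul_mem _ _ (Submodule.subset_span ⟨i, rfl⟩)
  rw [Module.finrank_eq_card_basis (Module.Basis.mk li sp), Fintype.card_fin]

lemma nak {E : Type*} [AddCommGroup E] (P N : Submodule ℤ E) (hP : P.FG)
    (h : ∀ p : ℕ, p.Prime → ∀ w ∈ P, ∃ a ∈ N, ∃ y ∈ P, w = a + (p : ℤ) • y) : P ≤ N := by
  have h1 : ∀ p : ℕ, p.Prime → ∃ r : ℤ, (p : ℤ) ∣ r - 1 ∧ ∀ w ∈ P, r • w ∈ N := by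
    intro p hp
    obtain ⟨r, hr, hr'⟩ := Submodule.exists_sub_one_mem_and_smul_le_of_fg_of_le_sup
      (I := Ideal.span {(p : ℤ)}) (N := N) hP le_rfl (by
        intro w hw
        obtain ⟨a, ha, y, hy, rfl⟩ := h p hp w hw
        exact Submodule.add_mem_sup ha
          (Submodule.smul_mem_smul (Ideal.mem_span_singleton_self _) hy))
    exact ⟨r, Ideal.mem_span_singleton.1 hr, fun w hw => hr' (Submodule.smul_mem_pointwise_smul w r P hw)⟩
  let J : Ideal ℤ :=
    { carrier := {r | ∀ w ∈ P, r • w ∈ N}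
      zero_mem' := fun w _ => by simp
      add_mem' := fun {a b} ha hb w hw => by rw [add_smul]; exact add_mem (ha w hw) (hb w hw)
      smul_mem' := fun c a ha w hw => by
        rw [smul_eq_mul, mul_smul]; exact N.smul_mem c (ha w hw) }
  obtain ⟨a, ha⟩ := (IsPrincipalIdealRing.principal J).principal
  by_cases h2 : a.natAbs = 1
  · have : (1 : ℤ) ∈ J := by
      rw [ha]
      exact Ideal.mem_span_singleton.2 (Int.isUnit_iff_natAbs_eq.2 h2).dvd
    intro w hw
    simpa using this w hw
  · exfalso
    have hp := Nat.minFac_prime h2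
    obtain ⟨r, hr, hr'⟩ := h1 _ hp
    have h3 : r ∈ J := hr'
    rw [ha] at h3
    have h4 : a ∣ r := Ideal.mem_span_singleton.1 h3
    have h5 : ((a.natAbs.minFac : ℕ) : ℤ) ∣ r :=
      (Int.natCast_dvd.2 (Nat.minFac_dvd _)).trans h4
    have h6 := (dvd_sub h5 hr)
    rw [sub_sub_cancel] at h6
    have := Int.natCast_dvd_natCast.1 (by simpa using h6 : ((a.natAbs.minFac : ℕ) : ℤ) ∣ ((1:ℕ) : ℤ))
    exact hp.one_lt.ne' (Nat.dvd_one.1 this)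

lemma MM_step {ι κ : Type*} [Fintype κ] [Fintype ι] (F : Matrix ι κ ℤ[X])
    (hF : LinearIndependent ℤ[X] F.row) {d : ℕ} (hd : ∀ i j, (F i j).natDegree ≤ d) (k : ℕ)
    (hk : Fintype.card ι * d + 1 ≤ k) :
    MM F (k+1) ≤ MM F k ⊔ (MM F k).map (TX ℤ κ) := by
  obtain ⟨C, hC⟩ := MM_upper F hF
  have hrm : Fintype.card ι ≤ Fintype.card κ := by
    by_contra hlt
    have := hC (Fintype.card κ * C + 1)
    push Not at hlt
    have h3 := Nat.mul_le_mul_right (Fintype.card κ * C + 1) (Nat.succ_le_of_lt hlt)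
    rw [Nat.succ_mul] at h3
    rw [mul_add _ (_ + 1) C] at this
    omega
  obtain ⟨s, hs⟩ := Nat.exists_eq_add_of_le hrm
  have hl : ∀ k, s * k ≤ Module.finrank ℤ (MM F k) + Fintype.card ι * d := by
    intro k
    have := MM_lower F hd k
    rw [hs] at this
    nlinarith
  have hu : ∀ k, Module.finrank ℤ (MM F k) ≤ s * k + Fintype.card κ * C := by
    intro k
    have h1 := hC k
    have h2 := Submodule.finrank_mono (MM_mono F (show k ≤ k + C by omega))
    rw [mul_add] at h1
    nth_rewrite 1 [hs] at h1
    nlinarith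
  have h00 : Module.finrank ℤ (MM F 0) = 0 := by
    have := Submodule.finrank_mono (inf_le_left : MM F 0 ≤ DD ℤ κ 0)
    rw [DDfinrank, mul_zero] at this
    exact Nat.le_zero.1 this
  have hsl := convex_slope (g := fun k => Module.finrank ℤ (MM F k)) h00 (MM_convex F) hl (K := 0)
    (fun k _ => hu k)
  beta_reduce at hsl
  apply nak _ _ (Module.Finite.iff_fg.1 inferInstance)
  intro p hp w hw
  have : Fact p.Prime := ⟨hp⟩
  have hp0 : (p : ℤ) ≠ 0 := by exact_mod_cast hp.ne_zero
  have key := field_step (TX (ZMod p) κ) (TX_inj _ _) (VV p F) (DD (ZMod p) κ)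
    (by rintro k _ ⟨w, hw, rfl⟩; exact ⟨w, MM_mono F (by omega) hw, rfl⟩)
    (by rintro k _ ⟨w, hw, rfl⟩; exact ⟨TX ℤ κ w, TX_MM.2 hw, red_TX p w⟩)
    (by
      rintro k _ ⟨w, hw, rfl⟩
      have := mem_DD.1 (mem_MM.1 hw).1
      refine mem_DD.2 fun j i hi => ?_
      rw [red_coeff, this j i hi, Int.cast_zero])
    (fun k w h => TX_DD.1 h) (Fintype.card κ) s (Fintype.card ι * d) (Fintype.card κ * C)
    (fun k => (DDfinrank _ _ _).le)
    (by simpa only [VV_finrank] using hl) (by simpa only [VV_finrank] using hu)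
    (by simpa only [VV_finrank] using hsl) k hk
  have hm := key ⟨w, hw, rfl⟩
  obtain ⟨_, ⟨a, ha, rfl⟩, _, ⟨_, ⟨b, hb, rfl⟩, rfl⟩, hab⟩ := Submodule.mem_sup.1 hm
  have hz : red p (w - (a + TX ℤ κ b)) = 0 := by
    rw [map_sub, map_add, red_TX, hab, sub_self]
  obtain ⟨y, hy⟩ := red_eq_zero p hz
  refine ⟨a + TX ℤ κ b, Submodule.add_mem_sup ha ⟨b, hb, rfl⟩, y, ?_, by rw [← hy]; abel⟩
  apply MM_sat hp0
  rw [← hy]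
  exact sub_mem hw (add_mem (MM_mono F (by omega) ha) (TX_MM.2 hb))

lemma MM_span {ι κ : Type*} [Fintype κ] [Fintype ι] (F : Matrix ι κ ℤ[X])
    (hF : LinearIndependent ℤ[X] F.row) {d N : ℕ} (hd : ∀ i j, (F i j).natDegree ≤ d)
    (hN : Fintype.card ι * d ≤ N) (t : ℕ) :
    ∀ w ∈ MM F (N + 1 + t), w ∈ Submodule.span ℤ[X] (MM F (N+1) : Set (κ → ℤ[X])) := by
  induction t with
  | zero => intro w hw; exact Submodule.subset_span hw
  | succ t ih =>
    intro w hw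
    obtain ⟨a, ha, _, ⟨b, hb, rfl⟩, rfl⟩ :=
      Submodule.mem_sup.1 (MM_step F hF hd (N+1+t) (by omega) hw)
    exact add_mem (ih a ha) (Submodule.smul_mem _ (X : ℤ[X]) (ih b hb))

theorem stmt12 {n m : ℕ} (F : Matrix (Fin n) (Fin m) (Polynomial ℤ))
    (d : ℕ) (hd : ∀ i j, (F i j).natDegree ≤ d) :
    ∃ S : Finset (Fin m → Polynomial ℤ),
      (∀ v ∈ S, ∀ j, (v j).natDegree ≤ n * d) ∧
      ∀ Y : Fin m → Polynomial ℤ,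
        Y ∈ Submodule.span (Polynomial ℤ) (↑S : Set (Fin m → Polynomial ℤ)) ↔
        F.mulVec Y = 0 := by
  classical
  obtain ⟨I, hI, hmax⟩ := exists_maximal_linearIndepOn ℤ[X] F.row
  have hIf : Fintype I := Fintype.ofFinite _
  let F' : Matrix I (Fin m) ℤ[X] := fun i => F i
  have hF' : LinearIndependent ℤ[X] F'.row := hI
  have hcard : Fintype.card I * d ≤ n * d := by
    have : Fintype.card I ≤ Fintype.card (Fin n) := Fintype.card_le_of_injective _ Subtype.val_injective
    rw [Fintype.card_fin] at this
    exact Nat.mul_le_mul_right _ this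
  have hker : ∀ Y, F.mulVec Y = 0 ↔ F'.mulVec Y = 0 := by
    intro Y
    constructor
    · intro h
      ext1 i
      exact congrFun h i.1
    · intro h
      let φ : (Fin m → ℤ[X]) →ₗ[ℤ[X]] ℤ[X] :=
        { toFun := fun v => dotProduct v Y
          map_add' := fun a b => add_dotProduct a b Y
          map_smul' := fun a b => smul_dotProduct a b Y }
      have hsp : Submodule.span ℤ[X] (F.row '' I) ≤ LinearMap.ker φ := by
        rw [Submodule.span_le]
        rintro _ ⟨i, hi, rfl⟩
        exact congrFun h ⟨i, hi⟩
      ext1 i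
      by_cases hi : i ∈ I
      · exact congrFun h ⟨i, hi⟩
      · obtain ⟨a, ha, h2⟩ := hmax i hi
        have h3 : φ (a • F.row i) = 0 := hsp h2
        rw [map_smul] at h3
        exact (smul_eq_zero.1 h3).resolve_left ha
  obtain ⟨S, hS, hspan⟩ := (Submodule.fg_span_iff_fg_span_finset_subset
    (R := ℤ[X]) (MM F' (n * d + 1) : Set (Fin m → ℤ[X]))).1 (IsNoetherian.noetherian _)
  refine ⟨S, fun v hv j => ?_, fun Y => ?_⟩
  · have := mem_DD.1 (mem_MM.1 (hS hv)).1 j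
    rw [natDegree_le_iff_coeff_eq_zero]
    exact fun i hi => this i hi
  · rw [← hspan, hker]
    constructor
    · intro h
      have : Submodule.span ℤ[X] (MM F' (n * d + 1) : Set (Fin m → ℤ[X])) ≤ LinearMap.ker F'.mulVecLin := by
        rw [Submodule.span_le]
        intro w hw
        exact (mem_MM.1 hw).2
      exact this h
    · intro h
      let t := Finset.univ.sup fun j => (Y j).natDegree + 1
      refine MM_span F' hF' (fun i j => hd i.1 j) hcard t Y (mem_MM.2 ⟨mem_DD.2 fun j i hi => ?_, h⟩)
      have : (Y j).natDegree + 1 ≤ t :=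
        Finset.le_sup (f := fun j => (Y j).natDegree + 1) (Finset.mem_univ j)
      exact coeff_eq_zero_of_natDegree_lt (by omega)
end

section
/- Let A ∈ ℤ^{n×m} be an integer matrix of rank r ≥ 1 and height h (the logarithm of the maximum absolute value of its entries). Then the ℤ-module Sol_ℤ(A) = {Y ∈ ℤ^m : AY = 0} can be generated by m − r vectors, each of whose entries v satisfies log|v| ≤ 2r(h + log r + 1). -/
theorem hnf_aux : ∀ (k : ℕ) (L : AddSubgroup (Fin k → ℤ)), L.index ≠ 0 →
    ∃ v : Fin k → Fin k → ℤ, (∀ i, v i ∈ L) ∧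
      (∀ y ∈ L, y ∈ Submodule.span ℤ (Set.range v)) ∧
      (∀ i, ∑ j, |v i j| ≤ (L.index : ℤ)) ∧
      ∀ w : Fin k → ℤ, ∃ u ∈ L, ∑ j, |w j - u j| ≤ (L.index : ℤ) - 1 := by
  intro k
  induction k with
  | zero =>
    intro L hL
    refine ⟨fun i => i.elim0, fun i => i.elim0, fun y _ => ?_, fun i => i.elim0, fun w => ⟨0, L.zero_mem, ?_⟩⟩
    · rw [Subsingleton.elim y 0]; exact Submodule.zero_mem _
    · simp; omega
  | succ k ih =>
    intro L hL
    let p : (Fin (k+1) → ℤ) →+ ℤ := Pi.evalAddMonoidHom (fun _ => ℤ) 0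
    let q : (Fin k → ℤ) →+ (Fin (k+1) → ℤ) :=
      { toFun := fun y => Fin.cons 0 y
        map_zero' := by ext i; refine Fin.cases ?_ (fun i => ?_) i <;> simp
        map_add' := by intro x y; ext i; refine Fin.cases ?_ (fun i => ?_) i <;> simp }
    have hq : ∀ y, q y = Fin.cons 0 y := fun y => rfl
    have hqr : q.range = p.ker := by
      ext z
      constructor
      · rintro ⟨y, rfl⟩; simp [AddMonoidHom.mem_ker, p, hq]
      · intro hz
        have hz0 : z 0 = 0 := hz
        refine ⟨Fin.tail z, ?_⟩
        rw [hq, ← hz0, Fin.cons_self_tail]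
    have hpsurj : Function.Surjective p := fun a => ⟨fun _ => a, rfl⟩
    obtain ⟨a, ha⟩ := Int.subgroup_cyclic (L.map p)
    rw [← AddSubgroup.zmultiples_eq_closure] at ha
    have hind : L.index = (L.comap q).index * a.natAbs := by
      rw [AddSubgroup.index_comap, hqr, ← AddSubgroup.relIndex_sup_left, ← Int.index_zmultiples, ← ha,
        AddSubgroup.index_map, AddMonoidHom.range_eq_top_of_surjective _ hpsurj, AddSubgroup.index_top, mul_one,
        AddSubgroup.relIndex_mul_index le_sup_left]
    have hN0 : (L.comap q).index ≠ 0 := fun h => hL (by rw [hind, h, zero_mul])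
    have ha0 : a.natAbs ≠ 0 := fun h => hL (by rw [hind, h, mul_zero])
    have haZ : a ≠ 0 := by omega
    obtain ⟨v, hvL, hvs, hvb, hvc⟩ := ih (L.comap q) hN0
    have hamem : a ∈ L.map p := by rw [ha]; exact AddSubgroup.mem_zmultiples a
    obtain ⟨w0, hw0L, hw0⟩ := hamem
    obtain ⟨u0, hu0, hu0b⟩ := hvc (Fin.tail w0)
    have hw00 : w0 0 = a := hw0
    set N : ℤ := ((L.comap q).index : ℤ) with hN
    have hN1 : 1 ≤ N := by omega
    have haa : 1 ≤ |a| := Int.one_le_abs haZ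
    have hindZ : (L.index : ℤ) = N * |a| := by rw [hind]; push_cast; simp [hN]
    set w1 : Fin (k+1) → ℤ := w0 - q u0 with hw1
    have hw1L : w1 ∈ L := L.sub_mem hw0L hu0
    have hw10 : w1 0 = a := by simp [hw1, hq, hw00]
    have hw1s : ∀ j, w1 (Fin.succ j) = Fin.tail w0 j - u0 j := by
      intro j; simp [hw1, hq, Fin.tail]
    rw [hindZ]
    refine ⟨Fin.cons w1 (fun i => q (v i)), ?_, ?_, ?_, ?_⟩
    · intro i
      refine Fin.cases ?_ (fun i => ?_) i
      · simpa using hw1L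
      · simpa using! hvL i
    · intro y hy
      have : y 0 ∈ L.map p := ⟨y, hy, rfl⟩
      rw [ha] at this
      obtain ⟨c, hc⟩ := AddSubgroup.mem_zmultiples_iff.1 this
      have hy' : y - c • w1 ∈ L := L.sub_mem hy (L.zsmul_mem hw1L c)
      have hy0 : y - c • w1 ∈ q.range := by
        rw [hqr, AddMonoidHom.mem_ker]
        change y 0 - c • w1 0 = 0
        rw [hw10, hc, sub_self]
      obtain ⟨z, hz⟩ := hy0
      have hzL : z ∈ L.comap q := by rw [AddSubgroup.mem_comap, hz]; exact hy'
      have hz2 := Submodule.mem_map_of_mem (f := q.toIntLinearMap) (hvs z hzL)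
      rw [Submodule.map_span, ← Set.range_comp] at hz2
      have hyy : y = q z + c • w1 := by rw [hz]; simp
      rw [hyy]
      refine Submodule.add_mem _ ?_ (Submodule.smul_mem _ _ (Submodule.subset_span ⟨0, by simp⟩))
      refine Submodule.span_mono ?_ hz2
      rintro _ ⟨i, rfl⟩
      exact ⟨i.succ, by simp⟩
    · intro i
      refine Fin.cases ?_ (fun i => ?_) i
      · rw [Fin.sum_univ_succ]
        simp only [Fin.cons_zero, hw10, hw1s]
        nlinarith
      · rw [Fin.sum_univ_succ]
        simp only [Fin.cons_succ, hq, Fin.cons_zero, abs_zero, zero_add]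
        have := hvb i
        nlinarith
    · intro w
      have hwd := Int.emod_add_mul_ediv (w 0) a
      obtain ⟨u, hu, hub⟩ := hvc (Fin.tail (w - (w 0 / a) • w1))
      refine ⟨(w 0 / a) • w1 + q u, L.add_mem (L.zsmul_mem hw1L _) hu, ?_⟩
      rw [Fin.sum_univ_succ]
      have h1 : w 0 - ((w 0 / a) • w1 + q u) 0 = w 0 % a := by
        simp [hq, hw10]; linarith
      have h2 : ∀ j : Fin k, w j.succ - ((w 0 / a) • w1 + q u) j.succ
          = Fin.tail (w - (w 0 / a) • w1) j - u j := by
        intro j; simp [hq, Fin.tail]; ring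
      simp only [h1, h2]
      have h3 : |w 0 % a| ≤ |a| - 1 := by
        rw [abs_of_nonneg (Int.emod_nonneg _ haZ)]
        have := Int.emod_lt_abs (w 0) haZ
        omega
      nlinarith

theorem index_aux {r : ℕ} (B : Matrix (Fin r) (Fin r) ℤ) (hB : B.det ≠ 0) :
    (LinearMap.range B.mulVecLin).toAddSubgroup.index = B.det.natAbs := by
  have hinj : Function.Injective B.mulVecLin := by
    simpa using! Matrix.mulVec_injective_of_det_ne_zero hB
  have := Submodule.natAbs_det_equiv _ (LinearEquiv.ofInjective B.mulVecLin hinj)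
  rw [AddSubgroup.index]
  refine Eq.trans this.symm ?_
  have h2 : ((LinearMap.range B.mulVecLin).subtype ∘ₗ AddMonoidHom.toIntLinearMap
    ((LinearEquiv.ofInjective B.mulVecLin hinj : (Fin r → ℤ) ≃ₗ[ℤ] _) : (Fin r → ℤ) →+ (LinearMap.range B.mulVecLin)))
     = Matrix.toLin' B := by
    ext; simp
  erw [h2]
  rw [LinearMap.det_toLin']

theorem rows_aux {n m r : ℕ} (A : Matrix (Fin n) (Fin m) ℚ) (hr : A.rank = r) :
    ∃ f : Fin r → Fin n, LinearIndependent ℚ (fun s => A (f s)) ∧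
      ∀ i, A i ∈ Submodule.span ℚ (Set.range fun s => A (f s)) := by
  rw [A.rank_eq_finrank_span_row] at hr
  subst hr
  obtain ⟨R, hR, hRs, hRi⟩ := Submodule.exists_fun_fin_finrank_span_eq ℚ (Set.range A.row)
  choose f hf using hR
  have hfR : (fun s => A (f s)) = R := funext hf
  refine ⟨f, ?_, ?_⟩
  · rw [hfR]; exact hRi
  · intro i
    rw [hfR, hRs]
    exact Submodule.subset_span ⟨i, rfl⟩

theorem minor_aux {n m r : ℕ} (A : Matrix (Fin n) (Fin m) ℚ) (hr : A.rank = r) :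
    ∃ (f : Fin r → Fin n) (g : Fin r → Fin m), (A.submatrix f g).det ≠ 0 ∧
      ∀ i, A i ∈ Submodule.span ℚ (Set.range fun s => A (f s)) := by
  obtain ⟨f, hf, hs⟩ := rows_aux A hr
  have h1 : (A.submatrix f id).transpose.rank = r := by
    rw [Matrix.rank_transpose]
    have := LinearIndependent.rank_matrix (M := A.submatrix f id) hf
    simpa using this
  obtain ⟨g, hg, -⟩ := rows_aux _ h1
  refine ⟨f, g, ?_, hs⟩
  have h2 : LinearIndependent ℚ (A.submatrix f g).transpose.row := hg
  rw [Matrix.linearIndependent_rows_iff_isUnit, Matrix.isUnit_iff_isUnit_det, Matrix.det_transpose] at h2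
  exact h2.ne_zero

theorem split_aux {m r : ℕ} (g : Fin r → Fin m) (hg : Function.Injective g) :
    ∃ e : Fin r ⊕ Fin (m - r) ≃ Fin m, ∀ s, e (Sum.inl s) = g s := by
  classical
  have hc : Fintype.card ((Set.range g)ᶜ : Set (Fin m)) = m - r := by
    rw [Fintype.card_compl_set, Set.card_range_of_injective hg]; simp
  refine ⟨((Equiv.ofInjective g hg).sumCongr (Fintype.equivFinOfCardEq hc).symm).trans
    (Equiv.Set.sumCompl (Set.range g)), fun s => ?_⟩
  simp

/-- Core integral statement. -/
theorem core_aux {r k : ℕ} (B : Matrix (Fin r) (Fin r) ℤ) (C : Matrix (Fin r) (Fin k) ℤ)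
    (hB : B.det ≠ 0) (H : ℤ) (hBH : ∀ i j, |B i j| ≤ H) (hCH : ∀ i j, |C i j| ≤ H) :
    ∃ (x : Fin k → Fin r → ℤ) (y : Fin k → Fin k → ℤ),
      (∀ i, B.mulVec (x i) + C.mulVec (y i) = 0) ∧
      (∀ i s, |x i s| ≤ r.factorial * H ^ r) ∧ (∀ i j, |y i j| ≤ r.factorial * H ^ r) ∧
      (∀ X Y, B.mulVec X + C.mulVec Y = 0 → ∃ c : Fin k → ℤ,
        X = ∑ i, c i • x i ∧ Y = ∑ i, c i • y i) := by
  have hinj : Function.Injective B.mulVec := Matrix.mulVec_injective_of_det_ne_zero hB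
  set M : ℤ := r.factorial * H ^ r with hM
  have hdet : ∀ D : Matrix (Fin r) (Fin r) ℤ, (∀ i j, |D i j| ≤ H) → |D.det| ≤ M := by
    intro D hD
    have := Matrix.det_le (A := D) (abv := AbsoluteValue.abs) (x := H) hD
    simpa [hM] using this
  let R := (LinearMap.range B.mulVecLin).toAddSubgroup
  let L : AddSubgroup (Fin k → ℤ) := R.comap C.mulVecLin.toAddMonoidHom
  have hRi : R.index = B.det.natAbs := index_aux B hB
  have hR0 : R.index ≠ 0 := by rw [hRi]; simpa using hB
  have hdvd : L.index ∣ R.index := by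
    rw [AddSubgroup.index_comap]; exact AddSubgroup.relIndex_dvd_index_of_normal _ _
  have hL0 : L.index ≠ 0 := fun h => hR0 (by rw [h] at hdvd; exact Nat.eq_zero_of_zero_dvd hdvd)
  have hLle : (L.index : ℤ) ≤ |B.det| := by
    have := Nat.le_of_dvd (Nat.pos_of_ne_zero hR0) hdvd
    rw [hRi] at this
    rw [Int.abs_eq_natAbs]
    exact_mod_cast this
  obtain ⟨y, hyL, hys, hyb, -⟩ := hnf_aux k L hL0
  have hyx : ∀ i, ∃ x, B.mulVec x + C.mulVec (y i) = 0 := by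
    intro i
    obtain ⟨x, hx⟩ := hyL i
    have hx' : B.mulVec x = C.mulVec (y i) := hx
    exact ⟨-x, by rw [Matrix.mulVec_neg, hx']; simp⟩
  choose x hx using hyx
  have hyd : ∀ i, ∑ j, |y i j| ≤ |B.det| := fun i => (hyb i).trans hLle
  refine ⟨x, y, hx, ?_, ?_, ?_⟩
  · intro i s
    have h1 : B.det • x i = -∑ j, y i j • B.cramer (fun t => C t j) := by
      have h2 : B.mulVec (x i) = -C.mulVec (y i) := eq_neg_of_add_eq_zero_left (hx i)
      have h3 : B.adjugate.mulVec (B.mulVec (x i)) = B.det • x i := by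
        rw [Matrix.mulVec_mulVec, Matrix.adjugate_mul, Matrix.smul_mulVec, Matrix.one_mulVec]
      rw [← h3, h2, Matrix.mulVec_neg, ← Matrix.cramer_eq_adjugate_mulVec]
      congr 1
      have h4 : C.mulVec (y i) = ∑ j, y i j • (fun t => C t j) := by
        ext t; simp [Matrix.mulVec, dotProduct, mul_comm]
      rw [h4, map_sum]
      exact Finset.sum_congr rfl fun j _ => map_smul _ _ _
    have h5 : B.det * x i s = -∑ j, y i j * B.cramer (fun t => C t j) s := by
      have := congrFun h1 s
      simpa using this
    have h6 : ∀ j, |B.cramer (fun t => C t j) s| ≤ M := by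
      intro j
      rw [Matrix.cramer_apply]
      apply hdet
      intro a b
      rw [Matrix.updateCol_apply]
      split_ifs
      · exact hCH _ _
      · exact hBH _ _
    have h7 : |B.det| * |x i s| ≤ |B.det| * M := by
      rw [← abs_mul, h5, abs_neg]
      calc _ ≤ ∑ j, |y i j * B.cramer (fun t => C t j) s| := Finset.abs_sum_le_sum_abs _ _
        _ ≤ ∑ j, |y i j| * M := by
          apply Finset.sum_le_sum
          intro j _
          rw [abs_mul]
          exact mul_le_mul_of_nonneg_left (h6 j) (abs_nonneg _)
        _ = (∑ j, |y i j|) * M := by rw [Finset.sum_mul]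
        _ ≤ |B.det| * M := mul_le_mul_of_nonneg_right (hyd i) ((abs_nonneg _).trans (hdet B hBH))
    exact le_of_mul_le_mul_left h7 (abs_pos.2 hB)
  · intro i j
    calc |y i j| ≤ ∑ j, |y i j| := Finset.single_le_sum (f := fun j => |y i j|) (fun _ _ => abs_nonneg _) (Finset.mem_univ j)
      _ ≤ _ := hyd i
      _ ≤ _ := hdet B hBH
  · intro X Y hXY
    have hYL : Y ∈ L := ⟨-X, by
      change B.mulVec (-X) = C.mulVec Y
      rw [Matrix.mulVec_neg]; exact neg_eq_of_add_eq_zero_right hXY⟩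
    obtain ⟨c, hc⟩ := (Submodule.mem_span_range_iff_exists_fun ℤ).1 (hys Y hYL)
    refine ⟨c, hinj ?_, hc.symm⟩
    have h8 : B.mulVec (∑ i, c i • x i) + C.mulVec (∑ i, c i • y i) = 0 := by
      have : ∀ i, B.mulVecLin (c i • x i) + C.mulVecLin (c i • y i) = 0 := by
        intro i
        rw [map_smul, map_smul, ← smul_add]
        have := hx i
        simp [this]
      change B.mulVecLin _ + C.mulVecLin _ = 0
      rw [map_sum, map_sum, ← Finset.sum_add_distrib]
      exact Finset.sum_eq_zero fun i _ => this i
    rw [hc] at h8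
    exact add_right_cancel (hXY.trans h8.symm)

/-- Let A ∈ ℤ^{n×m} have rank r ≥ 1 and height h. Then
Sol_ℤ(A) = {Y ∈ ℤ^m : AY = 0} can be generated by m − r vectors each of whose entries v
satisfies log|v| ≤ 2r(h + log r + 1). -/
theorem stmt14 {n m : ℕ} (A : Matrix (Fin n) (Fin m) ℤ)
    (r : ℕ) (hr1 : 1 ≤ r) (hr : (A.map fun a => (a : ℚ)).rank = r)
    (h : ℝ) (hh : ∀ i j, Real.log |(A i j : ℝ)| ≤ h) :
    ∃ v : Fin (m - r) → (Fin m → ℤ),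
      (∀ k j, Real.log |(v k j : ℝ)| ≤ 2 * (r : ℝ) * (h + Real.log (r : ℝ) + 1)) ∧
      ∀ Y : Fin m → ℤ, Y ∈ Submodule.span ℤ (Set.range v) ↔ A.mulVec Y = 0 := by
  obtain ⟨f, g, hdQ, hspan⟩ := minor_aux _ hr
  have hd : (A.submatrix f g).det ≠ 0 := by
    intro h0
    apply hdQ
    have : (A.map fun a => (a : ℚ)).submatrix f g = (Int.castRingHom ℚ).mapMatrix (A.submatrix f g) := rfl
    rw [this, ← RingHom.map_det, h0, map_zero]
  have hg : Function.Injective g := by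
    intro a b hab
    by_contra hne
    exact hd (Matrix.det_zero_of_column_eq hne fun i => by simp [hab])
  obtain ⟨e, he⟩ := split_aux g hg
  -- `h` is nonnegative
  have hlog0 : ∀ a : ℤ, 0 ≤ Real.log |(a : ℝ)| := by
    intro a
    by_cases ha : a = 0
    · simp [ha]
    · apply Real.log_nonneg
      exact_mod_cast Int.one_le_abs ha
  have hh0 : 0 ≤ h := (hlog0 _).trans (hh (f ⟨0, hr1⟩) (g ⟨0, hr1⟩))
  set H : ℤ := ⌊Real.exp h⌋ with hH
  have hHle : (H : ℝ) ≤ Real.exp h := Int.floor_le _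
  have hH1 : 1 ≤ H := by
    rw [hH, Int.le_floor]; simpa using hh0
  have hAH : ∀ i j, |A i j| ≤ H := by
    intro i j
    by_cases ha : A i j = 0
    · rw [ha, abs_zero]; omega
    · rw [hH, Int.le_floor]
      push_cast
      have hpos : 0 < |(A i j : ℝ)| := abs_pos.2 (by exact_mod_cast ha)
      exact (Real.log_le_iff_le_exp hpos).1 (hh i j)
  let C : Matrix (Fin r) (Fin (m - r)) ℤ := A.submatrix f (fun j => e (Sum.inr j))
  obtain ⟨x, y, hxy, hxb, hyb, hgen⟩ := core_aux (A.submatrix f g) C hd H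
    (fun i j => hAH _ _) (fun i j => hAH _ _)
  have hker : ∀ Y : Fin m → ℤ, A.mulVec Y = 0 ↔
      (A.submatrix f g).mulVec (fun s => Y (e (Sum.inl s))) + C.mulVec (fun j => Y (e (Sum.inr j))) = 0 := by
    intro Y
    have hrow : ∀ s, ((A.submatrix f g).mulVec (fun s => Y (e (Sum.inl s)))
        + C.mulVec (fun j => Y (e (Sum.inr j)))) s = A.mulVec Y (f s) := by
      intro s
      simp only [Pi.add_apply, Matrix.mulVec, dotProduct, Matrix.submatrix_apply, C]
      rw [← e.sum_comp, Fintype.sum_sum_type]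
      simp only [he]
    constructor
    · intro hY
      ext s
      rw [hrow, hY]; rfl
    · intro hY
      have hs : ∀ s, A.mulVec Y (f s) = 0 := fun s => by rw [← hrow, hY]; rfl
      ext i
      have key : ∀ w ∈ Submodule.span ℚ (Set.range fun s => (A.map fun a => (a : ℚ)) (f s)),
          dotProduct w (fun j => (Y j : ℚ)) = 0 := by
        intro w hw
        induction hw using Submodule.span_induction with
        | mem w hw =>
          obtain ⟨s, rfl⟩ := hw
          have := hs s
          simp only [Matrix.mulVec, dotProduct] at this ⊢
          simp only [Matrix.map_apply]
          exact_mod_cast this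
        | zero => simp
        | add a b _ _ ha hb => rw [add_dotProduct, ha, hb, add_zero]
        | smul c a _ ha => rw [smul_dotProduct, ha, smul_zero]
      have := key _ (hspan i)
      simp only [dotProduct, Matrix.map_apply] at this
      simp only [Matrix.mulVec, dotProduct, Pi.zero_apply]
      exact_mod_cast this
  refine ⟨fun k j => Sum.elim (x k) (y k) (e.symm j), ?_, ?_⟩
  · intro k j
    have hb : |Sum.elim (x k) (y k) (e.symm j)| ≤ r.factorial * H ^ r := by
      rcases e.symm j with s | s
      · exact hxb k s
      · exact hyb k s
    set a := Sum.elim (x k) (y k) (e.symm j)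
    have hr1' : (1 : ℝ) ≤ r := by exact_mod_cast hr1
    have hlr : 0 ≤ Real.log r := Real.log_nonneg hr1'
    have hmain : Real.log |(a : ℝ)| ≤ r * (h + Real.log r) := by
      by_cases ha : a = 0
      · simp only [ha, Int.cast_zero, abs_zero, Real.log_zero]
        positivity
      · have hpos : 0 < |(a : ℝ)| := abs_pos.2 (by exact_mod_cast ha)
        rw [Real.log_le_iff_le_exp hpos]
        have h1 : |(a : ℝ)| ≤ r.factorial * (H : ℝ) ^ r := by exact_mod_cast hb
        have h2 : (r.factorial : ℝ) ≤ (r : ℝ) ^ r := by exact_mod_cast Nat.factorial_le_pow r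
        have hHr : (1 : ℝ) ≤ H := by exact_mod_cast hH1
        have h3 : (H : ℝ) ^ r ≤ Real.exp h ^ r := pow_le_pow_left₀ (by linarith) hHle r
        have h4 : Real.exp (r * (h + Real.log r)) = (r : ℝ) ^ r * Real.exp h ^ r := by
          rw [Real.exp_nat_mul, Real.exp_add, Real.exp_log (by linarith), mul_pow, mul_comm]
        rw [h4]
        exact h1.trans (mul_le_mul h2 h3 (by positivity) (by positivity))
    have : 0 ≤ (r : ℝ) * (h + Real.log r) := by positivity
    linarith
  · intro Y
    rw [Submodule.mem_span_range_iff_exists_fun, hker]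
    constructor
    · rintro ⟨c, rfl⟩
      rw [← hker]
      change A.mulVecLin _ = 0
      rw [map_sum]
      refine Finset.sum_eq_zero fun i _ => ?_
      rw [map_smul]
      have : A.mulVec (fun j => Sum.elim (x i) (y i) (e.symm j)) = 0 := by
        rw [hker]; simpa using hxy i
      rw [Matrix.mulVecLin_apply, this, smul_zero]
    · intro hY
      obtain ⟨c, hX, hYc⟩ := hgen _ _ hY
      refine ⟨c, ?_⟩
      ext j
      obtain ⟨t, rfl⟩ := e.surjective j
      rcases t with s | s
      · have := congrFun hX s
        simpa using this.symm
      · have := congrFun hYc s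
        simpa using this.symm
end

section
/- Let F ∈ ℤ[x]^{n×m} be a matrix of full row rank n (over the fraction field ℚ(x)), with d = deg(F) ≥ 1 the maximum degree of its entries and h = height(F) the maximum height of its entries. Then the ℤ[x]-module Sol_{ℤ[x]}(F) = {Y ∈ ℤ[x]^m : FY = 0} can be generated by vectors whose degrees are at most n·d and whose heights are at most 2(n(n+1)d + n)(h + log(n(n+1)d + n) + 1). -/
open Polynomial

lemma aux_exists_minor {K κ : Type*} [Field K] [Fintype κ] {n : ℕ}
    (A : Matrix (Fin n) κ K) (hA : A.rank = n) :
    ∃ f : Fin n → κ, (A.submatrix id f).det ≠ 0 := by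
  classical
  have h1 := Submodule.exists_fun_fin_finrank_span_eq K (Set.range A.col)
  rw [← Matrix.rank_eq_finrank_span_cols, hA] at h1
  obtain ⟨c, hc, -, hli⟩ := h1
  choose f hf using hc
  refine ⟨f, ?_⟩
  have h2 : (A.submatrix id f).col = c := by
    funext i
    rw [← hf i]
    rfl
  have h3 : IsUnit (A.submatrix id f) := by
    rw [← Matrix.linearIndependent_cols_iff_isUnit, h2]
    exact hli
  exact ((Matrix.isUnit_iff_isUnit_det _).1 h3).ne_zero

/-- The integer kernel of a full-row-rank matrix is spanned by vectors of bounded entries. -/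
lemma aux_ker_full {κ : Type*} [Fintype κ] [DecidableEq κ] {r : ℕ} (A : Matrix (Fin r) κ ℤ) (H : ℝ)
    (hH : ∀ i j, (|A i j| : ℝ) ≤ H)
    (f₀ : Fin r → κ) (hf₀ : (A.submatrix id f₀).det ≠ 0)
    (y : κ → ℤ) (hy : A.mulVec y = 0) :
    y ∈ Submodule.span ℤ {v : κ → ℤ | A.mulVec v = 0 ∧
      ∀ k, (|v k| : ℝ) ≤ (Nat.factorial r : ℝ) * H ^ r} := by
  classical
  set W := Submodule.span ℤ {v : κ → ℤ | A.mulVec v = 0 ∧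
      ∀ k, (|v k| : ℝ) ≤ (Nat.factorial r : ℝ) * H ^ r} with hW
  let D : (Fin r → κ) → ℤ := fun f => (A.submatrix id f).det
  obtain ⟨g, hg⟩ := (IsPrincipalIdealRing.principal (Ideal.span (Set.range D))).principal
  rw [Ideal.submodule_span_eq] at hg
  have hgd : ∀ f, g ∣ D f := fun f => by
    rw [← Ideal.mem_span_singleton, ← hg]
    exact Ideal.subset_span ⟨f, rfl⟩
  have hg0 : g ≠ 0 := by
    rintro rfl
    exact hf₀ (zero_dvd_iff.1 (hgd f₀))
  have hDb : ∀ f, (|D f| : ℝ) ≤ (Nat.factorial r : ℝ) * H ^ r := fun f => by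
    have := Matrix.det_le (A := (A.submatrix id f)) (abv := (AbsoluteValue.abs.comp
      (f := Int.castRingHom ℝ) Int.cast_injective)) (x := H) (fun i j => by
        exact hH i (f j))
    rw [Fintype.card_fin, nsmul_eq_mul] at this
    exact this
  have hpos : (0 : ℝ) ≤ (Nat.factorial r : ℝ) * H ^ r := (abs_nonneg _).trans (hDb f₀)
  have hcr : ∀ f j i, (A.submatrix id f).cramer (fun k => A k j) i = D (Function.update f i j) := by
    intro f j i
    rw [Matrix.cramer_apply]
    congr 1
    ext a b
    simp only [Matrix.updateCol_apply, Matrix.submatrix_apply, id, Function.update_apply]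
    split_ifs <;> rfl
  -- the vectors u
  let u : (Fin r → κ) → κ → κ → ℤ := fun f j k =>
    (if k = j then D f else 0) - ∑ i, if k = f i then D (Function.update f i j) else 0
  have hu : ∀ f j k, u f j k = (if k = j then D f else 0) -
    ∑ i, if k = f i then D (Function.update f i j) else 0 := fun _ _ _ => rfl
  have huA : ∀ f j, A.mulVec (u f j) = 0 := by
    intro f j
    funext a
    have h1 := congrFun (Matrix.mulVec_cramer (A.submatrix id f) (fun k => A k j)) a
    simp only [Matrix.mulVec, dotProduct, hcr] at h1
    simp only [Matrix.mulVec, dotProduct, u, mul_sub, Finset.sum_sub_distrib, Finset.mul_sum,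
      Pi.zero_apply, mul_ite, mul_zero]
    rw [Finset.sum_comm]
    simp only [Finset.sum_ite_eq', Finset.sum_ite_eq, Finset.mem_univ, if_true]
    simp only [Matrix.submatrix_apply, id, Pi.smul_apply, smul_eq_mul] at h1
    rw [h1]
    simp only [D]
    ring
  have huy : ∀ f, D f • y = ∑ j, y j • u f j := by
    intro f
    funext k
    have h2 : ∀ i, ∑ j, y j * D (Function.update f i j) = 0 := by
      intro i
      have h3 : (A.submatrix id f).cramer (A.mulVec y) i = 0 := by rw [hy]; simp
      have h4 : A.mulVec y = ∑ j, y j • (fun k => A k j) := by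
        funext a
        simp [Matrix.mulVec, dotProduct, mul_comm]
      rw [h4, map_sum] at h3
      simp only [map_smul, Finset.sum_apply, Pi.smul_apply, hcr, smul_eq_mul] at h3
      exact h3
    simp only [Finset.sum_apply, Pi.smul_apply, smul_eq_mul, u, mul_sub, Finset.sum_sub_distrib,
      Finset.mul_sum, mul_ite, mul_zero]
    rw [Finset.sum_comm]
    have h5 : ∀ i, (∑ j, if k = f i then y j * D (Function.update f i j) else 0) = 0 := by
      intro i
      split_ifs
      · exact h2 i
      · simp
    simp [h5, mul_comm]
  have huW : ∀ f j, D f ≠ 0 → ∃ w ∈ W, u f j = g • w := by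
    intro f j hf
    have hinj : Function.Injective f := by
      intro a b hab
      by_contra hne
      exact hf (Matrix.det_zero_of_column_eq hne (fun i => by simp [hab]))
    have hent : ∀ k, ∃ f', u f j k = 0 ∨ u f j k = D f' ∨ u f j k = - D f' := by
      intro k
      by_cases hk : ∃ i, k = f i
      · obtain ⟨i, rfl⟩ := hk
        have hs : (∑ i', if f i = f i' then D (Function.update f i' j) else 0)
            = D (Function.update f i j) := by
          simp [hinj.eq_iff]
        by_cases hj : f i = j
        · refine ⟨f, Or.inl ?_⟩
          have : Function.update f i j = f := by rw [← hj]; simp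
          rw [hu, hs, this, if_pos hj, sub_self]
        · refine ⟨Function.update f i j, Or.inr (Or.inr ?_)⟩
          rw [hu, hs, if_neg hj]; simp
      · push Not at hk
        have hs : (∑ i', if k = f i' then D (Function.update f i' j) else 0) = 0 := by
          simp [hk]
        refine ⟨f, ?_⟩
        by_cases hj : k = j
        · right; left; rw [hu, hs, if_pos hj, sub_zero]
        · left; rw [hu, hs, if_neg hj]; simp
    have hdv : ∀ k, g ∣ u f j k := by
      intro k
      obtain ⟨f', h | h | h⟩ := hent k <;> rw [h]
      · exact dvd_zero _
      · exact hgd _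
      · exact (hgd _).neg_right
    have hb : ∀ k, (|u f j k| : ℝ) ≤ (Nat.factorial r : ℝ) * H ^ r := by
      intro k
      obtain ⟨f', h | h | h⟩ := hent k <;> rw [h]
      · simpa using hpos
      · exact hDb _
      · simpa using hDb f'
    choose w hw using hdv
    refine ⟨w, Submodule.subset_span ⟨?_, ?_⟩, ?_⟩
    · have h1 := huA f j
      have h2 : u f j = g • w := by funext k; simp [hw k]
      rw [h2, Matrix.mulVec_smul] at h1
      exact (smul_eq_zero.1 h1).resolve_left hg0
    · intro k
      refine le_trans ?_ (hb k)
      rw [hw k]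
      have h1 : |w k| ≤ |g * w k| := by
        rw [abs_mul]
        have := Int.one_le_abs hg0
        nlinarith [abs_nonneg (w k)]
      exact_mod_cast h1
    · funext k; simp [hw k]
  have key : ∀ f, D f • y ∈ W.map (LinearMap.lsmul ℤ (κ → ℤ) g) := by
    intro f
    by_cases hf : D f = 0
    · rw [hf, zero_smul]; exact zero_mem _
    rw [huy f]
    refine sum_mem fun j _ => Submodule.smul_mem _ _ ?_
    obtain ⟨w, hw, h⟩ := huW f j hf
    exact ⟨w, hw, h.symm⟩
  have key2 : ∀ c ∈ Ideal.span (Set.range D), c • y ∈ W.map (LinearMap.lsmul ℤ (κ → ℤ) g) := by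
    intro c hc
    induction hc using Submodule.span_induction with
    | mem x h => obtain ⟨f, rfl⟩ := h; exact key f
    | zero => rw [zero_smul]; exact zero_mem _
    | add a b _ _ ha hb => rw [add_smul]; exact add_mem ha hb
    | smul a b _ hb => rw [smul_assoc]; exact Submodule.smul_mem _ _ hb
  obtain ⟨w, hw, hwy⟩ := key2 g (by rw [hg]; exact Ideal.mem_span_singleton_self g)
  have : w = y := smul_right_injective _ hg0 hwy
  exact this ▸ hw

lemma aux_ker {ι κ : Type*} [Fintype ι] [Fintype κ] [DecidableEq κ] (A : Matrix ι κ ℤ) (H : ℝ)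
    (hH1 : 1 ≤ H) (hH : ∀ i j, (|A i j| : ℝ) ≤ H)
    (y : κ → ℤ) (hy : A.mulVec y = 0) :
    y ∈ Submodule.span ℤ {v : κ → ℤ | A.mulVec v = 0 ∧
      ∀ k, (|v k| : ℝ) ≤ ((Fintype.card ι : ℝ) * H) ^ (Fintype.card ι)} := by
  classical
  let B : Matrix ι κ ℚ := A.map (Int.castRingHom ℚ)
  have h1 := Submodule.exists_fun_fin_finrank_span_eq ℚ (Set.range B.row)
  set r := Module.finrank ℚ (Submodule.span ℚ (Set.range B.row)) with hr
  have hrc : r ≤ Fintype.card ι := finrank_range_le_card _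
  obtain ⟨c, hc, hspan, hli⟩ := h1
  choose e he using hc
  let A' : Matrix (Fin r) κ ℤ := A.submatrix e id
  have hB' : (A'.map (Int.castRingHom ℚ)).row = c := by
    funext i
    rw [← he i]; rfl
  have hrk : (A'.map (Int.castRingHom ℚ)).rank = r := by
    have := LinearIndependent.rank_matrix (M := A'.map (Int.castRingHom ℚ)) (by rw [hB']; exact hli)
    simpa using this
  obtain ⟨f₀, hf₀⟩ := aux_exists_minor _ hrk
  have hf₀' : (A'.submatrix id f₀).det ≠ 0 := by
    intro h0
    apply hf₀
    have := RingHom.map_det (Int.castRingHom ℚ) (A'.submatrix id f₀)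
    rw [h0, map_zero] at this
    exact this.symm
  have hker : ∀ v : κ → ℤ, A'.mulVec v = 0 → A.mulVec v = 0 := by
    intro v hv
    have h2 : ∀ w ∈ Submodule.span ℚ (Set.range B.row), w ⬝ᵥ (fun k => (v k : ℚ)) = 0 := by
      rw [← hspan]
      intro w hw
      induction hw using Submodule.span_induction with
      | mem x h =>
        obtain ⟨i, rfl⟩ := h
        rw [← hB']
        have := congrFun hv i
        simp only [Matrix.mulVec, dotProduct, Pi.zero_apply] at this
        simp only [dotProduct, Matrix.row, Matrix.map_apply, eq_intCast]
        exact_mod_cast this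
      | zero => simp
      | add a b _ _ ha hb => rw [add_dotProduct, ha, hb, add_zero]
      | smul a b _ hb => rw [smul_dotProduct, hb, smul_zero]
    funext i
    have := h2 (B.row i) (Submodule.subset_span ⟨i, rfl⟩)
    simp only [dotProduct, Matrix.row, B, Matrix.map_apply, eq_intCast] at this
    simp only [Matrix.mulVec, dotProduct, Pi.zero_apply]
    exact_mod_cast this
  have := aux_ker_full A' H (fun i j => hH _ _) f₀ hf₀' y (by
    funext i
    exact congrFun hy (e i))
  refine Submodule.span_mono ?_ this
  rintro v ⟨hv, hb⟩
  refine ⟨hker v hv, fun k => (hb k).trans ?_⟩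
  rcases Nat.eq_zero_or_pos (Fintype.card ι) with h0 | h0
  · have : r = 0 := by omega
    rw [h0]; simp [this]
  have h1 : (1 : ℝ) ≤ Fintype.card ι := by exact_mod_cast h0
  rw [mul_pow]
  have hfac : (Nat.factorial r : ℝ) ≤ (Fintype.card ι : ℝ) ^ r := by
    have : Nat.factorial r ≤ Fintype.card ι ^ r := (Nat.factorial_le_pow r).trans
      (Nat.pow_le_pow_left hrc r)
    exact_mod_cast this
  have hfac2 : (Fintype.card ι : ℝ) ^ r ≤ (Fintype.card ι : ℝ) ^ (Fintype.card ι) :=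
    pow_le_pow_right₀ h1 hrc
  have h3 : H ^ r ≤ H ^ (Fintype.card ι) := pow_le_pow_right₀ hH1 hrc
  gcongr
  exact hfac.trans hfac2

lemma aux_rank_nullity {R E E' : Type} [CommRing R] [IsDomain R] [IsNoetherianRing R]
    [AddCommGroup E] [Module R E] [AddCommGroup E'] [Module R E']
    (W : Submodule R E) (hW : W.FG) (f : E →ₗ[R] E') :
    Module.finrank R (W.map f) + Module.finrank R (W ⊓ LinearMap.ker f : Submodule R E)
      = Module.finrank R W := by
  have : Module.Finite R W := Module.Finite.iff_fg.2 hW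
  have h := (LinearMap.ker (f.domRestrict W)).finrank_quotient_add_finrank
  rw [LinearEquiv.finrank_eq (f.domRestrict W).quotKerEquivRange, LinearMap.range_domRestrict] at h
  rw [← h]
  congr 1
  have h2 : W ⊓ LinearMap.ker f = (LinearMap.ker (f.domRestrict W)).map W.subtype := by
    ext v
    simp [LinearMap.domRestrict_apply, and_comm]
  rw [h2]
  exact LinearEquiv.finrank_eq (Submodule.equivMapOfInjective _ W.subtype_injective _).symm

lemma aux_fg {R E : Type} [CommRing R] [IsNoetherianRing R]
    [AddCommGroup E] [Module R E] {W W' : Submodule R E} (hW : W.FG) (h : W' ≤ W) : W'.FG := by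
  have : IsNoetherian R W := isNoetherian_of_fg_of_noetherian W hW
  exact Submodule.FG.of_le hW h

lemma aux_mono {R E : Type} [CommRing R] [IsDomain R] [IsNoetherianRing R]
    [AddCommGroup E] [Module R E] {W W' : Submodule R E} (hW : W.FG) (h : W' ≤ W) :
    Module.finrank R W' ≤ Module.finrank R W := by
  have : Module.Finite R W := Module.Finite.iff_fg.2 hW
  exact Submodule.finrank_mono h

/-- the part of `W` which is mapped by `x` into `W`. -/
def auxK {R E : Type} [CommRing R] [AddCommGroup E] [Module R E] (x : E →ₗ[R] E)
    (W : Submodule R E) : Submodule R E := W ⊓ W.comap x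

lemma aux_conv_eq {R E : Type} [CommRing R] [IsDomain R] [IsNoetherianRing R]
    [AddCommGroup E] [Module R E] (x : E →ₗ[R] E) (W : Submodule R E) (hW : W.FG) :
    Module.finrank R (W.map (W.mkQ ∘ₗ x)) + Module.finrank R (auxK x W) = Module.finrank R W := by
  rw [← aux_rank_nullity W hW (W.mkQ ∘ₗ x), LinearMap.ker_comp, Submodule.ker_mkQ]
  rfl

lemma aux_conv {R E : Type} [CommRing R] [IsDomain R] [IsNoetherianRing R]
    [AddCommGroup E] [Module R E] (x : E →ₗ[R] E) (W : Submodule R E) (hW : W.FG) :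
    Module.finrank R (auxK x W) + Module.finrank R (auxK x W) ≤
      Module.finrank R W + Module.finrank R (auxK x (auxK x W)) := by
  have hK : auxK x W ≤ W := inf_le_left
  have h1 := aux_conv_eq x (auxK x W) (aux_fg hW hK)
  have h2 := aux_rank_nullity W hW (auxK x W).mkQ
  rw [Submodule.ker_mkQ, inf_eq_right.2 hK] at h2
  have h3 : (auxK x W).map ((auxK x W).mkQ ∘ₗ x) ≤ W.map (auxK x W).mkQ := by
    rw [Submodule.map_comp]
    apply Submodule.map_mono
    rintro _ ⟨v, hv, rfl⟩
    exact hv.2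
  have h4 := aux_mono (hW.map _) h3
  omega

lemma aux_arith (D : ℕ → ℕ) (m n d : ℕ) (h0 : D 0 = 0)
    (hc : ∀ N, D (N + 1) + D (N + 1) ≤ D N + D (N + 2))
    (hl : ∀ N, m * N ≤ D N + n * (N + d)) (hu : ∀ N, D N + n * N ≤ m * N)
    (N : ℕ) (hN : n * d ≤ N) : D (N + 1) + n = D N + m := by
  have hmono : ∀ a k, (D (a + 1) : ℤ) - D a ≤ D (a + k + 1) - D (a + k) := by
    intro a k
    induction k with
    | zero => simp
    | succ k ih =>
      have := hc (a + k)
      rw [show a + (k + 1) + 1 = a + k + 2 by ring, show a + (k + 1) = a + k + 1 by ring]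
      omega
  have h1 : (D (N + 1) : ℤ) - D N ≤ m - n := by
    by_contra hcon
    push Not at hcon
    have h2 : ∀ k : ℕ, (D N : ℤ) + k * (m - n + 1) ≤ D (N + k) := by
      intro k
      induction k with
      | zero => simp
      | succ k ih =>
        have := hmono N k
        rw [show N + (k + 1) = N + k + 1 by ring]
        push_cast
        nlinarith
    have h3 := h2 (m * N + 1)
    have h4 := hu (N + (m * N + 1))
    zify at h4
    push_cast at h3
    nlinarith [mul_nonneg (Int.natCast_nonneg n) (Int.natCast_nonneg N), Int.natCast_nonneg (D N)]
  have h5 : (m : ℤ) - n ≤ (D (N + 1) : ℤ) - D N := by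
    by_contra hcon
    push Not at hcon
    have h2 : ∀ k : ℕ, k ≤ N + 1 → (D k : ℤ) ≤ k * (m - n - 1) := by
      intro k
      induction k with
      | zero => simp [h0]
      | succ k ih =>
        intro hk
        have := hmono k (N - k)
        rw [show k + (N - k) = N by omega] at this
        have ih := ih (by omega)
        push_cast
        nlinarith
    have h3 := h2 (N + 1) le_rfl
    have h4 := hl (N + 1)
    zify at h4 hN
    push_cast at h3
    nlinarith
  omega

/-- vectors of polynomials of degree `< N`. -/
noncomputable def auxBox (R : Type) [CommRing R] (m N : ℕ) : Submodule R (Fin m → R[X]) :=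
  Submodule.pi Set.univ (fun _ => degreeLT R N)

lemma aux_mem_box {R : Type} [CommRing R] {m N : ℕ} {Y : Fin m → R[X]} :
    Y ∈ auxBox R m N ↔ ∀ j, (Y j).degree < N := by
  simp [auxBox, Submodule.mem_pi, mem_degreeLT]

noncomputable def auxBoxEquiv (R : Type) [CommRing R] (m N : ℕ) :
    auxBox R m N ≃ₗ[R] (Fin m → Fin N → R) :=
  LinearEquiv.trans (M₂ := Fin m → degreeLT R N)
  { toFun := fun Y j => ⟨Y.1 j, Y.2 j trivial⟩
    invFun := fun Z => ⟨fun j => (Z j).1, fun j _ => (Z j).2⟩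
    map_add' := fun _ _ => rfl
    map_smul' := fun _ _ => rfl
    left_inv := fun _ => rfl
    right_inv := fun _ => rfl } (LinearEquiv.piCongrRight fun _ => degreeLTEquiv R N)

lemma aux_box_fg (R : Type) [CommRing R] (m N : ℕ) : (auxBox R m N).FG :=
  Module.Finite.iff_fg.1 (Module.Finite.equiv (auxBoxEquiv R m N).symm)

lemma aux_box_finrank (R : Type) [CommRing R] [IsDomain R] (m N : ℕ) :
    Module.finrank R (auxBox R m N) = m * N := by
  rw [(auxBoxEquiv R m N).finrank_eq, Module.finrank_pi_fintype]
  simp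

/-- multiplication by the variable. -/
noncomputable def auxX (R : Type) [CommRing R] (m : ℕ) : (Fin m → R[X]) →ₗ[R] (Fin m → R[X]) where
  toFun Y j := X * Y j
  map_add' Y Z := by funext j; simp [mul_add]
  map_smul' c Y := by funext j; simp

lemma auxX_eq (R : Type) [CommRing R] (m : ℕ) (Y : Fin m → R[X]) :
    auxX R m Y = (X : R[X]) • Y := rfl

lemma aux_degX {R : Type} [CommRing R] {N : ℕ} {q : R[X]} :
    (X * q).degree < ((N + 1 : ℕ) : WithBot ℕ) ↔ q.degree < (N : WithBot ℕ) := by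
  rw [degree_lt_iff_coeff_zero, degree_lt_iff_coeff_zero]
  constructor
  · intro h k hk
    have := h (k + 1) (by omega)
    rwa [coeff_X_mul] at this
  · intro h k hk
    obtain ⟨k, rfl⟩ : ∃ l, k = l + 1 := ⟨k - 1, by omega⟩
    rw [coeff_X_mul]
    exact h k (by omega)

/-- dimension bound by iterating `auxK`. -/
lemma aux_dim {k : Type} [Field k] {m : ℕ} (t : ℕ) : ∀ (N : ℕ) (W : Submodule k (Fin m → k[X])),
    W ≤ auxBox k m (N + 1) →
    Module.finrank k W ≤ Module.finrank k (auxK (auxX k m) W) + t →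
    Module.finrank k (auxK (auxX k m) W) ≤ N * t := by
  have hle : ∀ (N : ℕ) (W : Submodule k (Fin m → k[X])),
    W ≤ auxBox k m (N + 1) → auxK (auxX k m) W ≤ auxBox k m N := by
    intro N W hW v hv
    have := aux_mem_box.1 (hW hv.2)
    exact aux_mem_box.2 fun j => aux_degX.1 (this j)
  intro N
  induction N with
  | zero =>
    intro W hW _
    have := aux_mono (aux_box_fg k m 0) (hle 0 W hW)
    rw [aux_box_finrank] at this
    simpa using this
  | succ N ih =>
    intro W hW h
    have h1 := aux_conv (auxX k m) W (aux_fg (aux_box_fg _ _ _) hW)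
    have h2 := ih (auxK (auxX k m) W) (hle _ W hW) (by omega)
    rw [add_mul]
    omega

/-- Solutions of degree `< N`. -/
noncomputable def auxS {n m : ℕ} (F : Matrix (Fin n) (Fin m) ℤ[X]) (N : ℕ) :
    Submodule ℤ (Fin m → ℤ[X]) :=
  auxBox ℤ m N ⊓ LinearMap.ker (F.mulVecLin.restrictScalars ℤ)

lemma aux_mem_S {n m : ℕ} {F : Matrix (Fin n) (Fin m) ℤ[X]} {N : ℕ} {Y : Fin m → ℤ[X]} :
    Y ∈ auxS F N ↔ (∀ j, (Y j).degree < N) ∧ F.mulVec Y = 0 := by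
  rw [auxS, Submodule.mem_inf, aux_mem_box]
  rfl

lemma aux_S_fg {n m : ℕ} (F : Matrix (Fin n) (Fin m) ℤ[X]) (N : ℕ) : (auxS F N).FG :=
  aux_fg (aux_box_fg ℤ m N) inf_le_left

lemma aux_S_mono {n m : ℕ} (F : Matrix (Fin n) (Fin m) ℤ[X]) (N : ℕ) :
    auxS F N ≤ auxS F (N + 1) := by
  intro Y hY
  rw [aux_mem_S] at hY ⊢
  exact ⟨fun j => (hY.1 j).trans_le (by exact_mod_cast Nat.le_succ N), hY.2⟩

lemma aux_K_S {n m : ℕ} (F : Matrix (Fin n) (Fin m) ℤ[X]) (N : ℕ) :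
    auxK (auxX ℤ m) (auxS F (N + 1)) = auxS F N := by
  ext Y
  constructor
  · rintro ⟨h1, h2⟩
    have h1 := aux_mem_S.1 h1
    have h2 := aux_mem_S.1 h2
    exact aux_mem_S.2 ⟨fun j => aux_degX.1 (h2.1 j), h1.2⟩
  · intro h
    refine ⟨aux_S_mono F N h, ?_⟩
    have h := aux_mem_S.1 h
    refine aux_mem_S.2 ⟨fun j => aux_degX.2 (h.1 j), ?_⟩
    rw [auxX_eq, Matrix.mulVec_smul, h.2, smul_zero]

lemma aux_S_rank {n m : ℕ} (F : Matrix (Fin n) (Fin m) ℤ[X]) (d : ℕ)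
    (hd : ∀ i j, (F i j).natDegree ≤ d) (f : Fin n → Fin m) (hf : (F.submatrix id f).det ≠ 0)
    (N : ℕ) : m * N ≤ Module.finrank ℤ (auxS F N) + n * (N + d) ∧
      Module.finrank ℤ (auxS F N) + n * N ≤ m * N := by
  have h1 := aux_rank_nullity (auxBox ℤ m N) (aux_box_fg _ _ _) (F.mulVecLin.restrictScalars ℤ)
  rw [aux_box_finrank] at h1
  change _ + Module.finrank ℤ (auxS F N) = _ at h1
  constructor
  · have h2 : (auxBox ℤ m N).map (F.mulVecLin.restrictScalars ℤ) ≤ auxBox ℤ n (N + d) := by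
      rintro _ ⟨Y, hY, rfl⟩
      have hY := aux_mem_box.1 hY
      refine aux_mem_box.2 fun i => ?_
      change (∑ j, F i j * Y j).degree < _
      rw [← mem_degreeLT]
      refine sum_mem fun j _ => ?_
      rw [mem_degreeLT]
      rcases eq_or_ne (Y j) 0 with h0 | h0
      · rw [h0, mul_zero, degree_zero]; exact WithBot.bot_lt_coe _
      have h3 := hY j
      rw [degree_eq_natDegree h0] at h3
      have h3 : (Y j).natDegree < N := by exact_mod_cast h3
      refine lt_of_le_of_lt degree_le_natDegree ?_
      have := natDegree_mul_le (p := F i j) (q := Y j)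
      have := hd i j
      exact_mod_cast (by omega : (F i j * Y j).natDegree < N + d)
    have h3 := aux_mono (aux_box_fg _ _ _) h2
    rw [aux_box_finrank] at h3
    omega
  · have h2 := aux_rank_nullity (auxBox ℤ n N) (aux_box_fg _ _ _)
      ((F.submatrix id f).mulVecLin.restrictScalars ℤ)
    have h3 : LinearMap.ker ((F.submatrix id f).mulVecLin.restrictScalars ℤ) = ⊥ := by
      rw [LinearMap.ker_eq_bot']
      intro Z hZ
      exact Matrix.eq_zero_of_mulVec_eq_zero hf hZ
    rw [aux_box_finrank, h3, inf_bot_eq, finrank_bot, add_zero] at h2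
    have h4 : (auxBox ℤ n N).map ((F.submatrix id f).mulVecLin.restrictScalars ℤ) ≤
        (auxBox ℤ m N).map (F.mulVecLin.restrictScalars ℤ) := by
      rintro _ ⟨Z, hZ, rfl⟩
      have hZ := aux_mem_box.1 hZ
      refine ⟨fun k => ∑ i, if f i = k then Z i else 0, ?_, ?_⟩
      · refine aux_mem_box.2 fun k => ?_
        rw [← mem_degreeLT]
        refine sum_mem fun i _ => ?_
        split_ifs
        · rw [mem_degreeLT]; exact hZ i
        · exact zero_mem _
      · funext i
        change ∑ k, F i k * (∑ i, if f i = k then Z i else 0) = ∑ j, F i (f j) * Z j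
        simp only [Finset.mul_sum]
        rw [Finset.sum_comm]
        simp
    have h5 := aux_mono ((aux_box_fg _ _ _).map _) h4
    omega

/-- reduction mod p -/
noncomputable def auxRed (p m : ℕ) :
    (Fin m → ℤ[X]) →ₛₗ[Int.castRingHom (ZMod p)] (Fin m → (ZMod p)[X]) where
  toFun Y j := (Y j).map (Int.castRingHom (ZMod p))
  map_add' Y Z := by funext j; simp
  map_smul' c Y := by
    funext j
    ext k
    simp

lemma auxRed_X (p m : ℕ) (Y : Fin m → ℤ[X]) :
    auxRed p m (auxX ℤ m Y) = auxX (ZMod p) m (auxRed p m Y) := by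
  funext j
  simp [auxRed, auxX]

lemma auxRed_zero {p m : ℕ} {Y : Fin m → ℤ[X]} (h : auxRed p m Y = 0) :
    ∃ Z, Y = (p : ℤ) • Z := by
  have h1 : ∀ j, ∃ q, Y j = (p : ℤ) • q := by
    intro j
    have h2 : C (p : ℤ) ∣ Y j := by
      rw [C_dvd_iff_dvd_coeff]
      intro k
      have h3 := congrArg (fun q => coeff q k) (congrFun h j)
      simp only [auxRed, LinearMap.coe_mk, AddHom.coe_mk, coeff_map, Pi.zero_apply,
        coeff_zero, eq_intCast] at h3
      exact (ZMod.intCast_zmod_eq_zero_iff_dvd _ _).1 h3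
    obtain ⟨q, hq⟩ := h2
    exact ⟨q, by rw [hq, smul_eq_C_mul]⟩
  choose Z hZ using h1
  exact ⟨Z, funext hZ⟩

lemma aux_S_sat {n m : ℕ} {F : Matrix (Fin n) (Fin m) ℤ[X]} {N : ℕ} {Y : Fin m → ℤ[X]} {c : ℤ}
    (hc : c ≠ 0) (h : c • Y ∈ auxS F N) : Y ∈ auxS F N := by
  rw [aux_mem_S] at h ⊢
  constructor
  · intro j
    have := h.1 j
    rwa [Pi.smul_apply, degree_smul_of_smul_regular _ (IsSMulRegular.of_ne_zero hc)] at this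
  · have h2 := h.2
    rw [Matrix.mulVec_smul] at h2
    exact (smul_eq_zero.1 h2).resolve_left hc

lemma auxRed_surj (p : ℕ) : RingHomSurjective (Int.castRingHom (ZMod p)) :=
  ⟨ZMod.ringHom_surjective _⟩

noncomputable def auxM {n m : ℕ} (F : Matrix (Fin n) (Fin m) ℤ[X]) (p N : ℕ) :
    Submodule (ZMod p) (Fin m → (ZMod p)[X]) :=
  have := auxRed_surj p
  (auxS F N).map (auxRed p m)

lemma aux_mem_M {n m : ℕ} {F : Matrix (Fin n) (Fin m) ℤ[X]} {p N : ℕ} {y} :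
    y ∈ auxM F p N ↔ ∃ Y ∈ auxS F N, auxRed p m Y = y := Iff.rfl

lemma aux_M_rank {n m : ℕ} (F : Matrix (Fin n) (Fin m) ℤ[X]) (p N : ℕ) [hp : Fact p.Prime] :
    Module.finrank (ZMod p) (auxM F p N) = Module.finrank ℤ (auxS F N) := by
  have : Module.Finite ℤ (auxS F N) := Module.Finite.iff_fg.2 (aux_S_fg F N)
  have hp0 : (p : ℤ) ≠ 0 := by exact_mod_cast hp.1.ne_zero
  let b := Module.finBasis ℤ (auxS F N)
  set D := Module.finrank ℤ (auxS F N)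
  let v : Fin D → (Fin m → (ZMod p)[X]) := fun i => auxRed p m (b i).1
  have hsum : ∀ c : Fin D → ℤ, ∑ i, (c i : ZMod p) • v i = auxRed p m (∑ i, c i • b i : auxS F N) := by
    intro c
    simp only [v, Submodule.coe_sum, map_sum, Submodule.coe_smul, LinearMap.map_smulₛₗ, eq_intCast]
  have hli : LinearIndependent (ZMod p) v := by
    rw [Fintype.linearIndependent_iff]
    intro g hg
    choose c hc using fun i => ZMod.intCast_surjective (g i)
    simp only [← hc] at hg ⊢
    rw [hsum] at hg
    obtain ⟨Z, hZ⟩ := auxRed_zero hg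
    have hZS : Z ∈ auxS F N := aux_S_sat hp0 (hZ ▸ Subtype.mem _)
    have h1 : ∑ i, c i • b i = (p : ℤ) • (⟨Z, hZS⟩ : auxS F N) := Subtype.ext hZ
    intro i
    have h2 := congrArg (fun w => b.repr w i) h1
    simp only [b.repr_sum_self, map_smul, Finsupp.smul_apply, smul_eq_mul] at h2
    rw [h2]
    simp
  have hspan : Submodule.span (ZMod p) (Set.range v) = auxM F p N := by
    apply le_antisymm
    · rw [Submodule.span_le]
      rintro _ ⟨i, rfl⟩
      exact aux_mem_M.2 ⟨_, (b i).2, rfl⟩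
    · intro y hy
      obtain ⟨Y, hY, rfl⟩ := aux_mem_M.1 hy
      have := b.sum_repr ⟨Y, hY⟩
      have h2 := hsum (b.repr ⟨Y, hY⟩)
      rw [this] at h2
      change _ = auxRed p m Y at h2
      rw [← h2]
      exact sum_mem fun i _ => Submodule.smul_mem _ _ (Submodule.subset_span ⟨i, rfl⟩)
  rw [← hspan, finrank_span_eq_card hli, Fintype.card_fin]

lemma aux_M_box {n m : ℕ} (F : Matrix (Fin n) (Fin m) ℤ[X]) (p N : ℕ) :
    auxM F p N ≤ auxBox (ZMod p) m N := by
  intro y hy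
  obtain ⟨Y, hY, rfl⟩ := aux_mem_M.1 hy
  refine aux_mem_box.2 fun j => ?_
  exact lt_of_le_of_lt degree_map_le ((aux_mem_S.1 hY).1 j)

lemma aux_step {n m : ℕ} (F : Matrix (Fin n) (Fin m) ℤ[X]) (d : ℕ)
    (hd : ∀ i j, (F i j).natDegree ≤ d) (f : Fin n → Fin m) (hf : (F.submatrix id f).det ≠ 0)
    (N : ℕ) (hN : n * d ≤ N) :
    auxS F (N + 2) ≤ auxS F (N + 1) ⊔ (auxS F (N + 1)).map (auxX ℤ m) := by
  set D : ℕ → ℕ := fun N => Module.finrank ℤ (auxS F N) with hD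
  have hlu := aux_S_rank F d hd f hf
  have hconv : ∀ N, D (N + 1) + D (N + 1) ≤ D N + D (N + 2) := by
    intro N
    have := aux_conv (auxX ℤ m) (auxS F (N + 2)) (aux_S_fg _ _)
    rw [aux_K_S, aux_K_S] at this
    simp only [hD]; omega
  have h0 : D 0 = 0 := by
    have := (hlu 0).2
    simp only [hD]; omega
  have har := aux_arith D m n d h0 hconv (fun N => (hlu N).1) (fun N => (hlu N).2)
  have har1 := har N hN
  have har2 := har (N + 1) (by omega)
  rw [show N + 1 + 1 = N + 2 by ring] at har2
  set T := auxS F (N + 1) ⊔ (auxS F (N + 1)).map (auxX ℤ m) with hT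
  have hTS : T ≤ auxS F (N + 2) := by
    refine sup_le (aux_S_mono F _) ?_
    rintro _ ⟨Y, hY, rfl⟩
    rw [SetLike.mem_coe, ← aux_K_S] at hY
    exact hY.2
  have hTfg : T.FG := aux_fg (aux_S_fg _ _) hTS
  -- the reduction mod p statement
  have hprime : ∀ (p : ℕ), p.Prime → ∀ Z ∈ auxS F (N + 2), (p : ℤ) • Z ∈ T → Z ∈ T := by
    intro p hp Z hZ hpZ
    have : Fact p.Prime := ⟨hp⟩
    have hp0 : (p : ℤ) ≠ 0 := by exact_mod_cast hp.ne_zero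
    obtain ⟨A, hA, _, ⟨B, hB, rfl⟩, hAB⟩ := Submodule.mem_sup.1 hpZ
    have hMK : auxM F p N ≤ auxK (auxX (ZMod p) m) (auxM F p (N + 1)) := by
      intro y hy
      obtain ⟨Y, hY, rfl⟩ := aux_mem_M.1 hy
      rw [← aux_K_S] at hY
      exact ⟨aux_mem_M.2 ⟨Y, hY.1, rfl⟩, aux_mem_M.2 ⟨_, hY.2, auxRed_X p m Y⟩⟩
    have hfgM : (auxM F p (N + 1)).FG := aux_fg (aux_box_fg _ _ _) (aux_M_box F p _)
    have hfgK : (auxK (auxX (ZMod p) m) (auxM F p (N + 1))).FG := aux_fg hfgM inf_le_left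
    have hKle : Module.finrank (ZMod p) (auxK (auxX (ZMod p) m) (auxM F p (N + 1))) ≤ D N := by
      by_contra hcon
      push Not at hcon
      have h1 : Module.finrank (ZMod p) (auxK (auxX (ZMod p) m) (auxM F p (N + 1))) ≤
        Module.finrank (ZMod p) (auxM F p (N + 1)) := aux_mono hfgM inf_le_left
      have h2 := aux_M_rank F p (N + 1)
      change _ = D (N + 1) at h2
      obtain ⟨t, rfl⟩ : ∃ t, m = n + t + 1 := ⟨m - n - 1, by omega⟩
      have h3 := aux_dim t N (auxM F p (N + 1)) (aux_M_box F p _) (by omega)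
      have h4 := (hlu N).1
      change _ ≤ D N + _ at h4
      nlinarith
    have hKM : auxM F p N = auxK (auxX (ZMod p) m) (auxM F p (N + 1)) := by
      have : Module.Finite (ZMod p) (auxK (auxX (ZMod p) m) (auxM F p (N + 1))) :=
        Module.Finite.iff_fg.2 hfgK
      exact Submodule.eq_of_le_of_finrank_le hMK (by rw [aux_M_rank]; exact hKle)
    have hredZ : auxRed p m ((p : ℤ) • Z) = 0 := by
      rw [LinearMap.map_smulₛₗ]; simp
    have hBM : auxRed p m B ∈ auxM F p N := by
      rw [hKM]
      refine ⟨aux_mem_M.2 ⟨B, hB, rfl⟩, aux_mem_M.2 ⟨-A, neg_mem hA, ?_⟩⟩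
      rw [← auxRed_X, map_neg, neg_eq_iff_add_eq_zero, ← map_add, hAB, hredZ]
    obtain ⟨B', hB', hBB'⟩ := aux_mem_M.1 hBM
    obtain ⟨B'', hB''⟩ := auxRed_zero (p := p) (Y := B - B') (by rw [map_sub, hBB', sub_self])
    have hB''S : B'' ∈ auxS F (N + 1) :=
      aux_S_sat hp0 (hB'' ▸ sub_mem hB (aux_S_mono F N hB'))
    have hxB' : auxX ℤ m B' ∈ auxS F (N + 1) := by
      rw [← aux_K_S] at hB'
      exact hB'.2
    have hAB' : A + auxX ℤ m B' = (p : ℤ) • (Z - auxX ℤ m B'') := by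
      rw [smul_sub, ← hAB, ← map_smul, ← hB'', map_sub]
      abel
    have hA'' : Z - auxX ℤ m B'' ∈ auxS F (N + 1) :=
      aux_S_sat hp0 (hAB' ▸ add_mem hA hxB')
    refine Submodule.mem_sup.2 ⟨_, hA'', _, ⟨B'', hB''S, rfl⟩, by abel⟩
  have hdiv_all : ∀ c : ℕ, c ≠ 0 → ∀ Z ∈ auxS F (N + 2), (c : ℤ) • Z ∈ T → Z ∈ T := by
    intro c
    induction c using Nat.recOnMul with
    | zero => intro h; exact absurd rfl h
    | one => intro _ Z _ h; simpa using h
    | prime p hp => intro _; exact hprime p hp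
    | mul a b iha ihb =>
      intro hab Z hZ h
      refine ihb (right_ne_zero_of_mul hab) Z hZ (iha (left_ne_zero_of_mul hab) _
        (Submodule.smul_mem _ _ hZ) ?_)
      rw [smul_smul]
      exact_mod_cast h
  -- finite index
  have hrkT : D (N + 2) ≤ Module.finrank ℤ T := by
    have h1 := aux_conv_eq (auxX ℤ m) (auxS F (N + 1)) (aux_S_fg _ _)
    rw [aux_K_S] at h1
    have h2 := aux_rank_nullity T hTfg (auxS F (N + 1)).mkQ
    rw [Submodule.ker_mkQ, inf_eq_right.2 (le_sup_left : _ ≤ T)] at h2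
    have h3 := aux_mono (hTfg.map (auxS F (N + 1)).mkQ)
      (show (auxS F (N + 1)).map ((auxS F (N + 1)).mkQ ∘ₗ auxX ℤ m) ≤ T.map (auxS F (N + 1)).mkQ by
        rw [Submodule.map_comp]
        exact Submodule.map_mono le_sup_right)
    change _ + D N = D (N + 1) at h1
    change _ + D (N + 1) = _ at h2
    omega
  have hq := aux_rank_nullity (auxS F (N + 2)) (aux_S_fg _ _) T.mkQ
  rw [Submodule.ker_mkQ, inf_eq_right.2 hTS] at hq
  change _ = D (N + 2) at hq
  have hq0 : Module.finrank ℤ ((auxS F (N + 2)).map T.mkQ) = 0 := by omega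
  intro Y hY
  have : Module.Finite ℤ ((auxS F (N + 2)).map T.mkQ) :=
    Module.Finite.iff_fg.2 ((aux_S_fg _ _).map _)
  obtain ⟨a, ha, haY⟩ := Module.finrank_eq_zero_iff.1 hq0 ⟨T.mkQ Y, ⟨Y, hY, rfl⟩⟩
  have haY : T.mkQ (a • Y) = 0 := by
    rw [map_smul]; exact congrArg Subtype.val haY
  rw [Submodule.mkQ_apply, Submodule.Quotient.mk_eq_zero] at haY
  refine hdiv_all a.natAbs (by simpa using ha) Y hY ?_
  rcases Int.natAbs_eq a with h | h
  · rwa [← h]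
  · have : ((a.natAbs : ℕ) : ℤ) = -a := by omega
    rw [this, neg_smul]
    exact neg_mem haY

lemma aux_gen {n m : ℕ} (F : Matrix (Fin n) (Fin m) ℤ[X]) (d : ℕ)
    (hd : ∀ i j, (F i j).natDegree ≤ d) (f : Fin n → Fin m) (hf : (F.submatrix id f).det ≠ 0)
    (Y : Fin m → ℤ[X]) (hY : F.mulVec Y = 0) :
    Y ∈ Submodule.span ℤ[X] (auxS F (n * d + 1) : Set (Fin m → ℤ[X])) := by
  have key : ∀ k, ∀ Y ∈ auxS F (n * d + 1 + k),
      Y ∈ Submodule.span ℤ[X] (auxS F (n * d + 1) : Set (Fin m → ℤ[X])) := by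
    intro k
    induction k with
    | zero => intro Y hY; exact Submodule.subset_span hY
    | succ k ih =>
      intro Y hY
      obtain ⟨A, hA, _, ⟨B, hB, rfl⟩, rfl⟩ := Submodule.mem_sup.1
        (aux_step F d hd f hf (n * d + k) (by omega)
          (show Y ∈ auxS F (n * d + k + 2) by convert hY using 2; ring))
      rw [show n * d + k + 1 = n * d + 1 + k by ring] at hA hB
      exact add_mem (ih A hA) (Submodule.smul_mem _ (X : ℤ[X]) (ih B hB))
  refine key (∑ j, (Y j).natDegree) Y (aux_mem_S.2 ⟨fun j => ?_, hY⟩)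
  refine lt_of_le_of_lt degree_le_natDegree ?_
  have := Finset.single_le_sum (f := fun j => (Y j).natDegree) (fun _ _ => Nat.zero_le _)
    (Finset.mem_univ j)
  exact_mod_cast (by omega :
    (Y j).natDegree < n * d + 1 + ∑ j, (Y j).natDegree)

noncomputable def auxP (m L : ℕ) : (Fin m × Fin L → ℤ) →ₗ[ℤ] (Fin m → ℤ[X]) where
  toFun w j := ∑ t : Fin L, w (j, t) • (X : ℤ[X]) ^ (t : ℕ)
  map_add' v w := by funext j; simp [add_mul, Finset.sum_add_distrib]
  map_smul' c w := by funext j; simp [Finset.mul_sum, mul_assoc]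

lemma auxP_apply (m L : ℕ) (w : Fin m × Fin L → ℤ) (j : Fin m) :
    auxP m L w j = ∑ t : Fin L, w (j, t) • (X : ℤ[X]) ^ (t : ℕ) := rfl

lemma auxP_coeff (m L : ℕ) (w : Fin m × Fin L → ℤ) (j : Fin m) (k : ℕ) :
    (auxP m L w j).coeff k = if h : k < L then w (j, ⟨k, h⟩) else 0 := by
  rw [auxP_apply, finsetSum_coeff]
  simp only [coeff_smul, coeff_X_pow, smul_eq_mul, mul_ite, mul_one, mul_zero]
  split_ifs with h
  · rw [Finset.sum_eq_single ⟨k, h⟩]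
    · simp
    · intro b _ hb
      rw [if_neg]
      rintro rfl
      exact hb rfl
    · simp
  · refine Finset.sum_eq_zero fun t _ => ?_
    rw [if_neg]
    rintro rfl
    exact h t.2

lemma auxP_mulVec {n m L : ℕ} (F : Matrix (Fin n) (Fin m) ℤ[X]) (w : Fin m × Fin L → ℤ)
    (i : Fin n) (s : ℕ) : (F.mulVec (auxP m L w) i).coeff s =
      ∑ q : Fin m × Fin L, (F i q.1 * X ^ (q.2 : ℕ)).coeff s * w q := by
  simp only [Matrix.mulVec, dotProduct, auxP_apply, finsetSum_coeff, Finset.mul_sum,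
    mul_smul_comm, coeff_smul, smul_eq_mul, Fintype.sum_prod_type, mul_comm (w _)]

lemma aux_height_le {q : ℤ[X]} {B : ℝ} (hB : 1 ≤ B) (h : ∀ k, (|q.coeff k| : ℝ) ≤ B) :
    polyHeight q ≤ Real.log B := by
  unfold polyHeight
  set M := (Finset.range (q.natDegree + 1)).sup fun k => (q.coeff k).natAbs with hM
  have h1 : M ≤ ⌊B⌋₊ := by
    refine Finset.sup_le fun k _ => Nat.le_floor ?_
    rw [Nat.cast_natAbs, Int.cast_abs]
    exact h k
  have h2 : (M : ℝ) ≤ B := (Nat.le_floor_iff (by linarith)).1 h1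
  rcases Nat.eq_zero_or_pos M with h0 | h0
  · rw [h0]; simpa using Real.log_nonneg hB
  · exact Real.log_le_log (by exact_mod_cast h0) h2

lemma aux_le_height {q : ℤ[X]} {h : ℝ} (hq : polyHeight q ≤ h) (k : ℕ) :
    (|q.coeff k| : ℝ) ≤ Real.exp h := by
  rcases eq_or_ne (q.coeff k) 0 with h0 | h0
  · rw [h0]; simpa using (Real.exp_pos h).le
  have h1 : (q.coeff k).natAbs ≤ (Finset.range (q.natDegree + 1)).sup
      fun k => (q.coeff k).natAbs :=
    Finset.le_sup (f := fun k => (q.coeff k).natAbs)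
      (Finset.mem_range.2 (Nat.lt_succ_of_le (le_natDegree_of_ne_zero h0)))
  have h2 : 0 < (q.coeff k).natAbs := Int.natAbs_pos.2 h0
  have h3 : (|q.coeff k| : ℝ) = ((q.coeff k).natAbs : ℝ) := by
    rw [Nat.cast_natAbs, Int.cast_abs]
  rw [h3, ← Real.log_le_iff_le_exp (by exact_mod_cast h2)]
  refine le_trans (Real.log_le_log (by exact_mod_cast h2) ?_) hq
  exact_mod_cast h1

lemma aux_height_nonneg (q : ℤ[X]) : 0 ≤ polyHeight q := Real.log_natCast_nonneg _

/-- Let F ∈ ℤ[x]^{n×m} have full row rank n over ℚ(x), with d = deg(F) ≥ 1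
and h = height(F). Then Sol_{ℤ[x]}(F) = {Y ∈ ℤ[x]^m : FY = 0} can be generated by vectors
of degree ≤ n·d and height ≤ 2(n(n+1)d + n)(h + log(n(n+1)d + n) + 1). -/
theorem stmt15 {n m : ℕ} (F : Matrix (Fin n) (Fin m) (Polynomial ℤ))
    (hrank : (F.map fun q =>
      algebraMap (Polynomial ℚ) (RatFunc ℚ) (q.map (Int.castRingHom ℚ))).rank = n)
    (d : ℕ) (hd1 : 1 ≤ d) (hd : ∀ i j, (F i j).natDegree ≤ d)
    (h : ℝ) (hh : ∀ i j, polyHeight (F i j) ≤ h) :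
    ∃ S : Finset (Fin m → Polynomial ℤ),
      (∀ v ∈ S, ∀ j, (v j).natDegree ≤ n * d ∧
        polyHeight (v j) ≤ 2 * ((n : ℝ) * ((n : ℝ) + 1) * (d : ℝ) + (n : ℝ)) *
          (h + Real.log ((n : ℝ) * ((n : ℝ) + 1) * (d : ℝ) + (n : ℝ)) + 1)) ∧
      ∀ Y : Fin m → Polynomial ℤ,
        Y ∈ Submodule.span (Polynomial ℤ) (↑S : Set (Fin m → Polynomial ℤ)) ↔
        F.mulVec Y = 0 := by
  classical
  -- a nonzero minor
  obtain ⟨f, hf⟩ := aux_exists_minor _ hrank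
  have hf' : (F.submatrix id f).det ≠ 0 := by
    intro h0
    apply hf
    have := RingHom.map_det ((algebraMap (Polynomial ℚ) (RatFunc ℚ)).comp
      (mapRingHom (Int.castRingHom ℚ))) (F.submatrix id f)
    rw [h0, map_zero] at this
    exact this.symm
  let L := n * d + 1
  let T := n * d + d + 1
  let R : ℕ := n * T
  let H : ℝ := max 1 (Real.exp h)
  have hH1 : 1 ≤ H := le_max_left _ _
  let B : ℝ := ((R : ℝ) * H) ^ R
  have hB : 1 ≤ B := by
    rcases Nat.eq_zero_or_pos R with h0 | h0
    · simp only [B, h0, pow_zero, le_refl]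
    · have : (1 : ℝ) ≤ R := by exact_mod_cast h0
      exact one_le_pow₀ (one_le_mul_of_one_le_of_one_le this hH1)
  let A : Matrix (Fin n × Fin T) (Fin m × Fin L) ℤ :=
    fun a b => (F a.1 b.1 * X ^ (b.2 : ℕ)).coeff a.2
  have hAH : ∀ a b, (|A a b| : ℝ) ≤ H := by
    intro a b
    simp only [A, coeff_mul_X_pow']
    split_ifs
    · exact (aux_le_height (hh _ _) _).trans (le_max_right _ _)
    · simp; linarith
  have hAF : ∀ w, A.mulVec w = 0 ↔ F.mulVec (auxP m L w) = 0 := by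
    intro w
    constructor
    · intro hw
      funext i
      ext s
      rw [auxP_mulVec, Pi.zero_apply, coeff_zero]
      by_cases hs : s < T
      · exact congrFun hw (i, ⟨s, hs⟩)
      · refine Finset.sum_eq_zero fun q _ => ?_
        have h1 := q.2.2
        have h2 := hd i q.1
        rw [coeff_mul_X_pow']
        split_ifs
        · rw [coeff_eq_zero_of_natDegree_lt (by omega), zero_mul]
        · rw [zero_mul]
    · intro hw
      funext a
      have := auxP_mulVec F w a.1 a.2
      rw [hw, Pi.zero_apply, coeff_zero] at this
      exact this.symm
  let V : Set (Fin m × Fin L → ℤ) := {v | A.mulVec v = 0 ∧ ∀ k, (|v k| : ℝ) ≤ B}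
  have hVfin : V.Finite := by
    refine (Set.finite_Icc (fun _ => -⌊B⌋ : Fin m × Fin L → ℤ) (fun _ => ⌊B⌋)).subset ?_
    rintro v ⟨-, hv⟩
    have h1 : ∀ k, |v k| ≤ ⌊B⌋ := fun k => Int.le_floor.2 (by rw [Int.cast_abs]; exact hv k)
    exact ⟨fun k => (abs_le.1 (h1 k)).1, fun k => (abs_le.1 (h1 k)).2⟩
  have hbound : Real.log B ≤ 2 * ((n : ℝ) * ((n : ℝ) + 1) * (d : ℝ) + (n : ℝ)) *
          (h + Real.log ((n : ℝ) * ((n : ℝ) + 1) * (d : ℝ) + (n : ℝ)) + 1) := by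
    have hR : (n : ℝ) * ((n : ℝ) + 1) * (d : ℝ) + (n : ℝ) = (R : ℝ) := by
      simp only [R, T]; push_cast; ring
    rw [hR]
    rcases Nat.eq_zero_or_pos n with h0 | h0
    · have hR0 : R = 0 := by simp [R, h0]
      simp [B, hR0]
    · have hh0 : 0 ≤ h := (aux_height_nonneg _).trans (hh ⟨0, h0⟩ (f ⟨0, h0⟩))
      have hHe : H = Real.exp h := max_eq_right (Real.one_le_exp hh0)
      have hRpos : 1 ≤ R := Nat.mul_pos h0 (by omega)
      have hR1 : (1 : ℝ) ≤ R := by exact_mod_cast hRpos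
      have hl := Real.log_nonneg hR1
      simp only [B]
      rw [Real.log_pow, hHe, Real.log_mul (by positivity) (Real.exp_pos h).ne', Real.log_exp]
      nlinarith [mul_nonneg (by linarith : (0 : ℝ) ≤ R) (by linarith : 0 ≤ h + Real.log R + 1)]
  refine ⟨hVfin.toFinset.image (auxP m L), ?_, ?_⟩
  · intro v hv j
    obtain ⟨w, hw, rfl⟩ := Finset.mem_image.1 hv
    obtain ⟨-, hw⟩ := hVfin.mem_toFinset.1 hw
    constructor
    · rw [natDegree_le_iff_coeff_eq_zero]
      intro k hk
      rw [auxP_coeff, dif_neg (by omega)]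
    · refine (aux_height_le hB fun k => ?_).trans hbound
      rw [auxP_coeff]
      split_ifs
      · exact hw _
      · simp; linarith
  · intro Y
    rw [Finset.coe_image, Set.Finite.coe_toFinset]
    constructor
    · intro hY
      have hle : Submodule.span ℤ[X] (auxP m L '' V) ≤ LinearMap.ker F.mulVecLin := by
        rw [Submodule.span_le]
        rintro _ ⟨w, hw, rfl⟩
        exact (hAF w).1 hw.1
      exact hle hY
    · intro hY
      have h1 := aux_gen F d hd f hf' Y hY
      refine Submodule.span_le.2 ?_ h1
      intro Z hZ
      obtain ⟨hZd, hZF⟩ := aux_mem_S.1 hZ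
      let y : Fin m × Fin L → ℤ := fun q => (Z q.1).coeff q.2
      have hPy : auxP m L y = Z := by
        funext j
        ext k
        rw [auxP_coeff]
        split_ifs with hk
        · rfl
        · exact ((degree_lt_iff_coeff_zero _ _).1 (hZd j) k (by omega)).symm
      have h2 := aux_ker A H hH1 hAH y ((hAF y).2 (by rw [hPy]; exact hZF))
      have hcard : Fintype.card (Fin n × Fin T) = R := by simp [R]
      rw [hcard] at h2
      have h3 : auxP m L y ∈ (Submodule.span ℤ V).map (auxP m L) := ⟨y, h2, rfl⟩
      rw [hPy, Submodule.map_span] at h3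
      exact Submodule.span_le_restrictScalars ℤ ℤ[X] _ h3
end
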